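/- arXiv:2106.09452 — 11 statements merged into one kernel-verified Lean document; each statement's English description precedes it below -/
import Mathlib

section
/- Fix n, N ∈ ℕ with n ≤ N and 2 ≤ N, k ∈ ℕ₀ and a > 0. Let P be a homogeneous harmonic polynomial on ℝ^{N+1} of degree k (i.e. Δ_{ℝ^{N+1}} P = 0). Then there exists a polynomial Q on ℝ^n with Q(p^N_n(z)) = P(z) for all z ∈ S^N(a) if and only if there exist real numbers b_K, one for each multi-index K ∈ ℕ₀^n with |K| = k, such that P = Σ_{K, |K|=k} b_K · P_{N,n,K} identically on ℝ^{N+1}. -/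
open MvPolynomial Filter Finset

/-- Laplacian of a multivariate polynomial, taken with respect to the variables in `s`. -/
noncomputable def lapOn {σ : Type*} [DecidableEq σ] (s : Finset σ)
    (p : MvPolynomial σ ℝ) : MvPolynomial σ ℝ :=
  ∑ i ∈ s, pderiv i (pderiv i p)

/-- `c_j(m) = -1/(2j(m+2j-1))`. -/
noncomputable def cSmall (m j : ℕ) : ℝ := -1 / ((2 * j) * ((m : ℝ) + 2 * j - 1))

/-- `C_j(m) = ∏_{l=1}^j c_l(m)`, with `C_0(m) = 1`. -/
noncomputable def cBig (m j : ℕ) : ℝ := ∏ l ∈ Finset.Icc 1 j, cSmall m l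

/-- The polynomial `|y|₂²` on `ℝ^{N+1} = ℝ^n × ℝ^{N-n+1}`. -/
noncomputable def ySq (n N : ℕ) : MvPolynomial (Fin (N + 1)) ℝ :=
  ∑ i ∈ Finset.univ.filter (fun i : Fin (N + 1) => n ≤ (i : ℕ)), X i ^ 2

/-- The monomial `x^K` in the first `n` variables, viewed on `ℝ^{N+1}`. -/
noncomputable def xPow (n N : ℕ) (h : n ≤ N) (K : Fin n → ℕ) : MvPolynomial (Fin (N + 1)) ℝ :=
  ∏ i : Fin n, X (Fin.castLE (h.trans (Nat.le_succ N)) i) ^ K i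

/-- The harmonic polynomial
`P_{N,n,K}(x,y) = Σ_{j=0}^{⌊|K|/2⌋} C_j(N−n) |y|₂^{2j} Δ^j_{ℝ^n} x^K` on `ℝ^{N+1}`. -/
noncomputable def Ppoly (n N : ℕ) (h : n ≤ N) (K : Fin n → ℕ) : MvPolynomial (Fin (N + 1)) ℝ :=
  ∑ j ∈ Finset.range ((∑ i, K i) / 2 + 1),
    C (cBig (N - n) j) *
      (ySq n N ^ j *
        (lapOn (Finset.univ.filter (fun i : Fin (N + 1) => (i : ℕ) < n)))^[j] (xPow n N h K))


namespace HHF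

lemma pderiv_rename_of_notMem {σ τ : Type*} (f : σ → τ) (i : τ) (hi : i ∉ Set.range f)
    (p : MvPolynomial σ ℝ) : pderiv i (rename f p) = 0 := by
  classical
  induction p using MvPolynomial.induction_on with
  | C a => simp
  | add p q hp hq => simp [hp, hq]
  | mul_X p j hp =>
    have : f j ≠ i := fun h => hi ⟨j, h⟩
    simp [hp, pderiv_X_of_ne this]

/-- inclusion of the first coordinates -/
abbrev inc {n N : ℕ} (h : n ≤ N) : Fin n → Fin (N + 1) := Fin.castLE (h.trans (Nat.le_succ N))

lemma inc_inj {n N : ℕ} (h : n ≤ N) : Function.Injective (inc h) := Fin.castLE_injective _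

lemma filter_eq {n N : ℕ} (h : n ≤ N) :
    (Finset.univ.filter (fun i : Fin (N + 1) => (i : ℕ) < n)) = Finset.univ.map ⟨inc h, inc_inj h⟩ := by
  ext i
  simp only [Finset.mem_filter, Finset.mem_univ, true_and, Finset.mem_map, Function.Embedding.coeFn_mk]
  constructor
  · intro hi
    exact ⟨⟨i, hi⟩, by ext; simp [inc]⟩
  · rintro ⟨j, rfl⟩
    simp [inc]

lemma not_range {n N : ℕ} (h : n ≤ N) (i : Fin (N + 1)) (hi : n ≤ (i : ℕ)) :
    i ∉ Set.range (inc h) := by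
  rintro ⟨j, rfl⟩
  simp [inc] at hi
  omega

lemma lapX_rename {n N : ℕ} (h : n ≤ N) (p : MvPolynomial (Fin n) ℝ) :
    lapOn (Finset.univ.filter (fun i : Fin (N + 1) => (i : ℕ) < n)) (rename (inc h) p)
      = rename (inc h) (lapOn Finset.univ p) := by
  rw [filter_eq h]
  simp [lapOn, pderiv_rename (inc_inj h)]

lemma lapX_iter_rename {n N : ℕ} (h : n ≤ N) (j : ℕ) (p : MvPolynomial (Fin n) ℝ) :
    (lapOn (Finset.univ.filter (fun i : Fin (N + 1) => (i : ℕ) < n)))^[j] (rename (inc h) p)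
      = rename (inc h) ((lapOn Finset.univ)^[j] p) := by
  induction j generalizing p with
  | zero => rfl
  | succ j ih => rw [Function.iterate_succ_apply, Function.iterate_succ_apply, lapX_rename, ih]

lemma xPow_eq {n N : ℕ} (h : n ≤ N) (K : Fin n → ℕ) :
    xPow n N h K = rename (inc h) (∏ i, X i ^ K i) := by
  simp [xPow, inc]

lemma pderiv_ySq_of_lt {n N : ℕ} (i : Fin (N + 1)) (hi : (i : ℕ) < n) :
    pderiv i (ySq n N) = 0 := by
  rw [ySq, map_sum]
  refine Finset.sum_eq_zero fun l hl => ?_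
  have : l ≠ i := by
    rintro rfl
    simp at hl
    omega
  rw [pderiv_pow, pderiv_X_of_ne this, mul_zero]

lemma pderiv_ySq_of_ge {n N : ℕ} (i : Fin (N + 1)) (hi : n ≤ (i : ℕ)) :
    pderiv i (ySq n N) = 2 * X i := by
  rw [ySq, map_sum, Finset.sum_eq_single i]
  · rw [pderiv_pow, pderiv_X_self]; norm_num
  · intro l _ hl
    rw [pderiv_pow, pderiv_X_of_ne hl, mul_zero]
  · intro h
    simp at h
    omega

lemma card_y {n N : ℕ} (h : n ≤ N) :
    (Finset.univ.filter (fun i : Fin (N + 1) => n ≤ (i : ℕ))).card = N - n + 1 := by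
  have h1 := Finset.card_filter_add_card_filter_not (s := (Finset.univ : Finset (Fin (N+1)))) 
    (fun i : Fin (N + 1) => (i : ℕ) < n)
  rw [filter_eq h] at h1
  simp at h1
  omega

/-- the eigen-coefficient -/
noncomputable def dd (m j : ℕ) : ℝ := 2 * j * (m + 2 * j - 1)

lemma lap_term {n N : ℕ} (h : n ≤ N) (j : ℕ) (p : MvPolynomial (Fin n) ℝ) :
    lapOn Finset.univ (ySq n N ^ j * rename (inc h) p)
      = ySq n N ^ j * rename (inc h) (lapOn Finset.univ p)
        + C (dd (N - n) j) * (ySq n N ^ (j - 1) * rename (inc h) p) := by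
  have hsplit : ∀ q : MvPolynomial (Fin (N + 1)) ℝ, lapOn Finset.univ q
      = lapOn (Finset.univ.filter (fun i : Fin (N + 1) => (i : ℕ) < n)) q
       + lapOn (Finset.univ.filter (fun i : Fin (N + 1) => n ≤ (i : ℕ))) q := by
    intro q
    unfold lapOn
    rw [← Finset.sum_filter_add_sum_filter_not Finset.univ (fun i : Fin (N + 1) => (i : ℕ) < n)]
    simp only [not_lt]
  rw [hsplit]
  congr 1
  · rw [← lapX_rename]
    unfold lapOn
    rw [Finset.mul_sum]
    refine Finset.sum_congr rfl fun i hi => ?_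
    have hi' : (i : ℕ) < n := by simpa using hi
    simp [pderiv_mul, pderiv_pow, pderiv_ySq_of_lt i hi']
  · unfold lapOn
    have key : ∀ i ∈ Finset.univ.filter (fun i : Fin (N + 1) => n ≤ (i : ℕ)),
        pderiv i (pderiv i (ySq n N ^ j * rename (inc h) p))
        = (C (2 * j : ℝ) * ySq n N ^ (j - 1) + C (4 * j * (j - 1 : ℕ) : ℝ) * ySq n N ^ (j - 1 - 1) * X i ^ 2)
          * rename (inc h) p := by
      intro i hi
      have hi' : n ≤ (i : ℕ) := by simpa using hi
      have h0 := pderiv_rename_of_notMem (inc h) i (not_range h i hi') p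
      have h2 : pderiv i (2 : MvPolynomial (Fin (N + 1)) ℝ) = 0 := by
        simpa using (pderiv i).map_natCast 2
      simp [pderiv_mul, pderiv_pow, pderiv_ySq_of_ge i hi', h0, h2]
      rw [show (C (2:ℝ) : MvPolynomial (Fin (N + 1)) ℝ) = 2 from map_ofNat C 2,
        show (C (4:ℝ) : MvPolynomial (Fin (N + 1)) ℝ) = 4 from map_ofNat C 4]
      ring
    rw [Finset.sum_congr rfl key, ← Finset.sum_mul, Finset.sum_add_distrib, ← Finset.mul_sum,
      Finset.sum_const, card_y h, ← Finset.mul_sum,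
      show (∑ i ∈ Finset.univ.filter (fun i : Fin (N + 1) => n ≤ (i : ℕ)), X i ^ 2) = ySq n N from rfl]
    have c2 : (C (2:ℝ) : MvPolynomial (Fin (N + 1)) ℝ) = 2 := map_ofNat C 2
    have c4 : (C (4:ℝ) : MvPolynomial (Fin (N + 1)) ℝ) = 4 := map_ofNat C 4
    generalize N - n = m
    rcases j with _ | _ | j
    · simp [dd]
    · simp [dd, c2, c4]
      left
      ring
    · simp [dd, c2, c4]
      ring

/-- restriction to a half-line in `y` -/
noncomputable def phi (n N : ℕ) : MvPolynomial (Fin (N + 1)) ℝ →ₐ[ℝ] Polynomial (MvPolynomial (Fin n) ℝ) :=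
  aeval (fun i : Fin (N + 1) => if hi : (i : ℕ) < n then Polynomial.C (X ⟨i, hi⟩)
    else if (i : ℕ) = N then Polynomial.X else 0)

lemma phi_rename {n N : ℕ} (h : n ≤ N) (p : MvPolynomial (Fin n) ℝ) :
    phi n N (rename (inc h) p) = Polynomial.C p := by
  have : (phi n N).comp (rename (inc h)) = (Polynomial.CAlgHom : MvPolynomial (Fin n) ℝ →ₐ[MvPolynomial (Fin n) ℝ] _).restrictScalars ℝ := by
    ext i
    simp [phi, inc]
  simpa using DFunLike.congr_fun this p

lemma phi_ySq {n N : ℕ} (h : n ≤ N) : phi n N (ySq n N) = Polynomial.X ^ 2 := by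
  rw [ySq, map_sum, Finset.sum_eq_single (Fin.last N)]
  · simp [phi, h]
  · intro i hi hl
    have h1 : n ≤ (i : ℕ) := by simpa using hi
    have h2 : (i : ℕ) ≠ N := fun hh => hl (by ext; simpa using hh)
    simp [phi, not_lt.mpr h1, h2]
  · intro hh
    simp [h] at hh

/-- the point `(x, t e)` -/
def pt (n N : ℕ) (x : Fin n → ℝ) (t : ℝ) : Fin (N + 1) → ℝ :=
  fun i => if hi : (i : ℕ) < n then x ⟨i, hi⟩ else if (i : ℕ) = N then t else 0

lemma eval_phi {n N : ℕ} (x : Fin n → ℝ) (t : ℝ) (P : MvPolynomial (Fin (N + 1)) ℝ) :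
    ((phi n N P).map (eval x)).eval t = eval (pt n N x t) P := by
  induction P using MvPolynomial.induction_on with
  | C a => simp [phi, Polynomial.algebraMap_apply]
  | add p q hp hq => simp [hp, hq]
  | mul_X p i hp =>
    rw [map_mul, Polynomial.map_mul, Polynomial.eval_mul, hp, map_mul]
    congr 1
    simp only [phi, aeval_X, eval_X, pt]
    split_ifs <;> simp

lemma eval_ySq {n N : ℕ} (h : n ≤ N) (z : Fin (N + 1) → ℝ) :
    eval z (ySq n N) = ∑ i, z i ^ 2 - ∑ i : Fin n, z (inc h i) ^ 2 := by
  rw [ySq, ← Finset.sum_filter_add_sum_filter_not Finset.univ (fun i : Fin (N + 1) => (i : ℕ) < n),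
    filter_eq h]
  simp [map_sum]

lemma eval_ySq_nonneg {n N : ℕ} (z : Fin (N + 1) → ℝ) : 0 ≤ eval z (ySq n N) := by
  rw [ySq, map_sum]
  exact Finset.sum_nonneg fun i _ => by simpa using sq_nonneg (z i)

lemma lap_homog {σ : Type*} [Fintype σ] [DecidableEq σ] {p : MvPolynomial σ ℝ} {k : ℕ}
    (hp : p.IsHomogeneous k) : (lapOn Finset.univ p).IsHomogeneous (k - 2) := by
  unfold lapOn
  refine IsHomogeneous.sum _ _ _ fun i _ => ?_
  exact (hp.pderiv (i := i)).pderiv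

lemma lap_zero {σ : Type*} [Fintype σ] [DecidableEq σ] {p : MvPolynomial σ ℝ} {k : ℕ}
    (hp : p.IsHomogeneous k) (hk : k < 2) : lapOn Finset.univ p = 0 := by
  unfold lapOn
  refine Finset.sum_eq_zero fun i _ => ?_
  have h1 : (pderiv i p).IsHomogeneous 0 := by
    have := hp.pderiv (i := i)
    rwa [show k - 1 = 0 by omega] at this
  rw [totalDegree_eq_zero_iff_eq_C.mp (Nat.le_zero.mp h1.totalDegree_le)]
  simp

lemma lap_iter_zero {σ : Type*} [Fintype σ] [DecidableEq σ] (j : ℕ) : ∀ (p : MvPolynomial σ ℝ) (k : ℕ),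
    p.IsHomogeneous k → k < 2 * j → (lapOn Finset.univ)^[j] p = 0 := by
  have h0 : lapOn Finset.univ (0 : MvPolynomial σ ℝ) = 0 := by simp [lapOn]
  induction j with
  | zero => intro p k _ hk; omega
  | succ j ih =>
    intro p k hp hk
    rw [Function.iterate_succ_apply]
    by_cases h2 : k < 2
    · rw [lap_zero hp h2]
      exact Function.iterate_fixed h0 j
    · exact ih _ _ (lap_homog hp) (by omega)

lemma lap_C_mul {σ : Type*} [DecidableEq σ] (s : Finset σ) (c : ℝ) (p : MvPolynomial σ ℝ) :
    lapOn s (C c * p) = C c * lapOn s p := by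
  simp [lapOn, pderiv_mul, Finset.mul_sum]

lemma lap_sum {σ ι : Type*} [DecidableEq σ] (s : Finset σ) (t : Finset ι)
    (p : ι → MvPolynomial σ ℝ) : lapOn s (∑ i ∈ t, p i) = ∑ i ∈ t, lapOn s (p i) := by
  simp only [lapOn, map_sum]
  exact Finset.sum_comm

lemma lap_iter_lin {σ ι : Type*} [DecidableEq σ] (s : Finset σ) (t : Finset ι)
    (c : ι → ℝ) (j : ℕ) : ∀ (p : ι → MvPolynomial σ ℝ),
    (lapOn s)^[j] (∑ i ∈ t, C (c i) * p i) = ∑ i ∈ t, C (c i) * (lapOn s)^[j] (p i) := by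
  induction j with
  | zero => intro p; rfl
  | succ j ih =>
    intro p
    simp only [Function.iterate_succ_apply]
    rw [lap_sum]
    simp only [lap_C_mul]
    exact ih _


lemma p0_homog {n N k : ℕ} {P : MvPolynomial (Fin (N + 1)) ℝ} (hP : P.IsHomogeneous k) :
    ((phi n N P).coeff 0).IsHomogeneous k := by
  have h : ∀ P : MvPolynomial (Fin (N + 1)) ℝ, (phi n N P).coeff 0
      = aeval (fun i : Fin (N + 1) => if hi : (i : ℕ) < n then (X ⟨i, hi⟩ : MvPolynomial (Fin n) ℝ)
        else 0) P := by
    intro P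
    induction P using MvPolynomial.induction_on with
    | C a => simp [phi, Polynomial.algebraMap_apply]
    | add p q hp hq => simp [hp, hq]
    | mul_X p i hp =>
      rw [map_mul, Polynomial.mul_coeff_zero, hp, map_mul]
      congr 1
      simp only [phi, aeval_X]
      split_ifs <;> simp
  rw [h]
  have := hP.aeval (fun i : Fin (N + 1) => if hi : (i : ℕ) < n then (X ⟨i, hi⟩ : MvPolynomial (Fin n) ℝ)
        else 0) (n := 1) (by
      intro i
      split_ifs
      · exact isHomogeneous_X _ _
      · exact isHomogeneous_zero _ _ _)
  simpa using this

lemma homog_expand {n k : ℕ} {p : MvPolynomial (Fin n) ℝ} (hp : p.IsHomogeneous k) :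
    p = ∑ K ∈ Finset.Nat.antidiagonalTuple n k,
      C (coeff (Finsupp.equivFunOnFinite.symm K) p) * ∏ i, X i ^ K i := by
  have hm : ∀ K : Fin n → ℕ, ∀ c : ℝ, C c * ∏ i, X i ^ K i
      = monomial (Finsupp.equivFunOnFinite.symm K) c := by
    intro K c
    rw [monomial_eq, Finsupp.prod_fintype _ _ (by simp)]
    simp
  simp only [hm]
  ext d
  rw [coeff_sum]
  simp only [coeff_monomial]
  by_cases hd : d.degree = k
  · rw [Finset.sum_eq_single (d : Fin n → ℕ)]
    · simp
    · intro K _ hK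
      rw [if_neg]
      rintro rfl
      exact hK (by simp)
    · intro hh
      exact absurd (Finset.Nat.mem_antidiagonalTuple.mpr (by
        rw [← hd, Finsupp.degree_eq_sum])) hh
  · rw [hp.coeff_eq_zero hd, Finset.sum_eq_zero]
    intro K hK
    rw [if_neg]
    rintro rfl
    apply hd
    rw [Finsupp.degree_eq_sum]
    simpa using Finset.Nat.mem_antidiagonalTuple.mp hK

lemma eval_smul_homog {σ : Type*} {P : MvPolynomial σ ℝ} {k : ℕ} (hP : P.IsHomogeneous k)
    (c : ℝ) (z : σ → ℝ) : eval (fun i => c * z i) P = c ^ k * eval z P := by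
  rw [eval_eq, eval_eq, Finset.mul_sum]
  refine Finset.sum_congr rfl fun d hd => ?_
  have h1 : d.degree = k := by
    by_contra hne
    exact (mem_support_iff.mp hd) (hP.coeff_eq_zero hne)
  simp only [mul_pow, Finset.prod_mul_distrib, Finset.prod_pow_eq_pow_sum]
  rw [show ∑ i ∈ d.support, d i = k from h1]
  ring

/-- The polynomial depends only on `x` and `|z|`. -/
lemma eval_congr {n N k : ℕ} (h : n ≤ N) (a : ℝ) (ha : 0 < a)
    {P : MvPolynomial (Fin (N + 1)) ℝ} (hP : P.IsHomogeneous k) (Q : MvPolynomial (Fin n) ℝ)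
    (hQ : ∀ z : Fin (N + 1) → ℝ, (∑ i, z i ^ 2) = a ^ 2 →
        eval (fun i : Fin n => z (inc h i)) Q = eval z P)
    (z w : Fin (N + 1) → ℝ) (hx : ∀ i, z (inc h i) = w (inc h i))
    (hs : ∑ i, z i ^ 2 = ∑ i, w i ^ 2) : eval z P = eval w P := by
  by_cases h0 : ∑ i, z i ^ 2 = 0
  · have hz : ∀ u : Fin (N + 1) → ℝ, ∑ i, u i ^ 2 = 0 → u = 0 := by
      intro u hu
      funext i
      have := (Finset.sum_eq_zero_iff_of_nonneg (fun i _ => sq_nonneg (u i))).mp hu i (Finset.mem_univ i)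
      simpa using this
    rw [hz z h0, hz w (hs ▸ h0)]
  · have hpos : 0 < ∑ i, z i ^ 2 :=
      lt_of_le_of_ne (Finset.sum_nonneg fun i _ => sq_nonneg _) (Ne.symm h0)
    set r := Real.sqrt (∑ i, z i ^ 2) with hr
    have hrpos : 0 < r := Real.sqrt_pos.mpr hpos
    have hr2 : r ^ 2 = ∑ i, z i ^ 2 := Real.sq_sqrt hpos.le
    have hsc : ∀ u : Fin (N + 1) → ℝ, ∑ i, u i ^ 2 = r ^ 2 → ∑ i, (a / r * u i) ^ 2 = a ^ 2 := by
      intro u hu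
      simp only [mul_pow]
      rw [← Finset.mul_sum, hu]
      field_simp
    have e1 := hQ _ (hsc z hr2.symm)
    have e2 := hQ _ (hsc w (by rw [hr2, hs]))
    simp only [hx] at e1
    rw [e1, eval_smul_homog hP, eval_smul_homog hP] at e2
    exact mul_left_cancel₀ (pow_ne_zero _ (div_pos ha hrpos).ne') e2

lemma pt_inc {n N : ℕ} (h : n ≤ N) (x : Fin n → ℝ) (t : ℝ) (i : Fin n) :
    pt n N x t (inc h i) = x i := by
  simp [pt, inc]

lemma eval_ySq_pt {n N : ℕ} (h : n ≤ N) (x : Fin n → ℝ) (t : ℝ) :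
    eval (pt n N x t) (ySq n N) = t ^ 2 := by
  rw [← eval_phi, phi_ySq h]
  simp

lemma sum_pt {n N : ℕ} (h : n ≤ N) (x : Fin n → ℝ) (t : ℝ) :
    ∑ i, pt n N x t i ^ 2 = ∑ i, x i ^ 2 + t ^ 2 := by
  have := eval_ySq h (pt n N x t)
  rw [eval_ySq_pt h] at this
  simp only [pt_inc] at this
  linarith

lemma even_coeff {f : Polynomial ℝ} (hf : ∀ t, f.eval t = f.eval (-t)) (i : ℕ) (hi : Odd i) :
    f.coeff i = 0 := by
  have : f = f.comp (Polynomial.C (-1) * Polynomial.X) := by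
    apply Polynomial.funext
    intro t
    simp [hf t]
  have h2 := congrArg (fun g => g.coeff i) this
  simp only [Polynomial.comp_C_mul_X_coeff, hi.neg_one_pow] at h2
  linarith

/-- Expansion in powers of `|y|²`. -/
lemma expand {n N k : ℕ} (h : n ≤ N) (a : ℝ) (ha : 0 < a)
    {P : MvPolynomial (Fin (N + 1)) ℝ} (hP : P.IsHomogeneous k) (Q : MvPolynomial (Fin n) ℝ)
    (hQ : ∀ z : Fin (N + 1) → ℝ, (∑ i, z i ^ 2) = a ^ 2 →
        eval (fun i : Fin n => z (inc h i)) Q = eval z P)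
    (M : ℕ) (hM : (phi n N P).natDegree < M) :
    P = ∑ j ∈ Finset.range M, ySq n N ^ j * rename (inc h) ((phi n N P).coeff (2 * j)) := by
  apply MvPolynomial.funext
  intro z
  set x : Fin n → ℝ := fun i => z (inc h i) with hxdef
  set t := Real.sqrt (eval z (ySq n N)) with ht
  have ht2 : t ^ 2 = eval z (ySq n N) := Real.sq_sqrt (eval_ySq_nonneg z)
  have hc := eval_congr h a ha hP Q hQ
  have e1 : eval z P = eval (pt n N x t) P := by
    apply hc
    · intro i; rw [pt_inc]
    · rw [sum_pt h, ht2, eval_ySq h]; simp [hxdef]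
  have e2 : ∀ s, ((phi n N P).map (eval x)).eval s = ((phi n N P).map (eval x)).eval (-s) := by
    intro s
    rw [eval_phi, eval_phi]
    apply hc
    · intro i; rw [pt_inc, pt_inc]
    · rw [sum_pt h, sum_pt h]; ring
  have hodd := even_coeff e2
  rw [e1, ← eval_phi]
  have hdeg : ((phi n N P).map (eval x)).natDegree < 2 * M := by
    have := Polynomial.natDegree_map_le (f := eval x) (p := phi n N P)
    omega
  rw [Polynomial.eval_eq_sum_range' hdeg]
  have hsum : ∀ (g : ℕ → ℝ), (∀ i, Odd i → g i = 0) → ∀ M, ∑ i ∈ Finset.range (2 * M), g i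
      = ∑ j ∈ Finset.range M, g (2 * j) := by
    intro g hg M
    induction M with
    | zero => simp
    | succ M ih =>
      rw [show 2 * (M + 1) = 2 * M + 1 + 1 by ring, Finset.sum_range_succ, Finset.sum_range_succ,
        ih, Finset.sum_range_succ, hg (2 * M + 1) ⟨M, rfl⟩, add_zero]
  rw [hsum _ (fun i hi => by rw [hodd i hi, zero_mul]), map_sum]
  refine Finset.sum_congr rfl fun j _ => ?_
  rw [map_mul, map_pow, ← ht2, eval_rename, Polynomial.coeff_map, ← pow_mul, mul_comm]
  rfl

lemma recur {n N : ℕ} (h : n ≤ N) (p : ℕ → MvPolynomial (Fin n) ℝ) (M : ℕ)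
    (hp : ∀ j, M ≤ j → p j = 0)
    (hl : lapOn Finset.univ (∑ j ∈ Finset.range M, ySq n N ^ j * rename (inc h) (p j)) = 0) (i : ℕ) :
    lapOn Finset.univ (p i) + C (dd (N - n) (i + 1)) * p (i + 1) = 0 := by
  have hl' := congrArg (fun g => (phi n N g).coeff (2 * i)) hl
  have hC : ∀ c : ℝ, phi n N (C c) = Polynomial.C (C c) := by
    intro c
    simp [phi, Polynomial.algebraMap_apply]
  simp only [lap_sum, lap_term h, map_sum, map_add, map_mul, map_pow, phi_ySq h, phi_rename h, hC,
    Polynomial.finsetSum_coeff, map_zero, Polynomial.coeff_zero, Polynomial.coeff_add,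
    Polynomial.coeff_C_mul, Polynomial.coeff_mul_C, ← pow_mul, Polynomial.coeff_X_pow] at hl'
  rw [Finset.sum_add_distrib] at hl'
  rw [← hl']
  have hlz : lapOn Finset.univ (0 : MvPolynomial (Fin n) ℝ) = 0 := by simp [lapOn]
  congr 1
  · by_cases hi : i < M
    · rw [Finset.sum_eq_single i]
      · simp
      · intro j _ hj
        rw [if_neg (by omega), zero_mul]
      · intro hh; simp at hh; omega
    · rw [hp i (by omega), hlz, Finset.sum_eq_zero]
      intro j hj
      simp at hj
      rw [if_neg (by omega), zero_mul]
  · by_cases hi : i + 1 < M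
    · rw [Finset.sum_eq_single (i + 1)]
      · simp
      · intro j _ hj
        rcases j with _ | j
        · simp [dd]
        · rw [if_neg (by simp; omega), zero_mul, mul_zero]
      · intro hh; simp at hh; omega
    · rw [hp (i + 1) (by omega), mul_zero, Finset.sum_eq_zero]
      intro j hj
      simp at hj
      rcases j with _ | j
      · simp [dd]
      · rw [if_neg (by simp; omega), zero_mul, mul_zero]

lemma recur_solve {n m : ℕ} (p : ℕ → MvPolynomial (Fin n) ℝ)
    (hp : ∀ i, lapOn Finset.univ (p i) + C (dd m (i + 1)) * p (i + 1) = 0) (j : ℕ) :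
    p j = C (cBig m j) * (lapOn Finset.univ)^[j] (p 0) := by
  induction j with
  | zero => simp [cBig]
  | succ j ih =>
    have h1 : cBig m (j + 1) = cBig m j * cSmall m (j + 1) := by
      rw [cBig, cBig, Finset.prod_Icc_succ_top (by omega)]
    have h2 : cSmall m (j + 1) * dd m (j + 1) = -1 := by
      have hne : (2 * ((j + 1 : ℕ) : ℝ)) * ((m : ℝ) + 2 * ((j + 1 : ℕ) : ℝ) - 1) ≠ 0 := by
        push_cast
        have : (0 : ℝ) < (2 * ((j : ℝ) + 1)) * ((m : ℝ) + 2 * ((j : ℝ) + 1) - 1) := by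
          have hm : (0 : ℝ) ≤ m := Nat.cast_nonneg m
          have hj : (0 : ℝ) ≤ j := Nat.cast_nonneg j
          apply mul_pos <;> linarith
        exact this.ne'
      rw [cSmall, dd, div_mul_cancel₀ _ hne]
    have h3 := congrArg (fun q => C (cSmall m (j + 1)) * q) (hp j)
    simp only [mul_add, mul_zero, ← mul_assoc, ← C_mul, h2] at h3
    rw [Function.iterate_succ_apply', h1, C_mul, mul_comm (C (cBig m j)), mul_assoc, ← lap_C_mul, ← ih]
    simp only [C_neg, C_1] at h3
    linear_combination -h3

lemma Ppoly_eq {n N k : ℕ} (h : n ≤ N) (K : Fin n → ℕ) (hK : ∑ i, K i = k) :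
    Ppoly n N h K = ∑ j ∈ Finset.range (k / 2 + 1), C (cBig (N - n) j) *
      (ySq n N ^ j * rename (inc h) ((lapOn Finset.univ)^[j] (∏ i, X i ^ K i))) := by
  simp only [Ppoly, hK, xPow_eq, lapX_iter_rename]

end HHF
/-- a homogeneous harmonic polynomial `P` of degree `k` on `ℝ^{N+1}` factors as a
polynomial in the first `n` coordinates on the sphere `S^N(a)` if and only if it is a linear
combination of the polynomials `P_{N,n,K}` with `|K| = k`. -/
theorem homogeneous_harmonic_factors_through_projection_iff
    (n N k : ℕ) (hn : 1 ≤ n) (hnN : n ≤ N) (hN : 2 ≤ N) (a : ℝ) (ha : 0 < a)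
    (P : MvPolynomial (Fin (N + 1)) ℝ) (hhom : P.IsHomogeneous k)
    (hharm : lapOn Finset.univ P = 0) :
    (∃ Q : MvPolynomial (Fin n) ℝ, ∀ z : Fin (N + 1) → ℝ, (∑ i, z i ^ 2) = a ^ 2 →
        MvPolynomial.eval (fun i : Fin n => z (Fin.castLE (hnN.trans (Nat.le_succ N)) i)) Q
          = MvPolynomial.eval z P) ↔
    (∃ b : (Fin n → ℕ) → ℝ,
        P = ∑ K ∈ Finset.Nat.antidiagonalTuple n k, MvPolynomial.C (b K) * Ppoly n N hnN K) := by
  constructor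
  · rintro ⟨Q, hQ⟩
    set p : ℕ → MvPolynomial (Fin n) ℝ := fun j => (HHF.phi n N P).coeff (2 * j) with hpdef
    set M := (HHF.phi n N P).natDegree + (k / 2 + 1) with hMdef
    have hexp := HHF.expand hnN a ha hhom Q hQ M (by omega)
    have hp0 : (p 0).IsHomogeneous k := HHF.p0_homog hhom
    have hrec := HHF.recur hnN p M (fun j hj =>
      Polynomial.coeff_eq_zero_of_natDegree_lt (by omega)) (by
        rw [hexp] at hharm; exact hharm)
    have hsol := HHF.recur_solve p hrec
    refine ⟨fun K => coeff (Finsupp.equivFunOnFinite.symm K) (p 0), ?_⟩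
    have hR : ∀ K ∈ Finset.Nat.antidiagonalTuple n k,
        C (coeff (Finsupp.equivFunOnFinite.symm K) (p 0)) * Ppoly n N hnN K
        = ∑ j ∈ Finset.range (k / 2 + 1), C (cBig (N - n) j) *
      (ySq n N ^ j * rename (HHF.inc hnN) (C (coeff (Finsupp.equivFunOnFinite.symm K) (p 0)) * 
        (lapOn Finset.univ)^[j] (∏ i, X i ^ K i))) := by
      intro K hK
      rw [HHF.Ppoly_eq hnN K (Finset.Nat.mem_antidiagonalTuple.mp hK), Finset.mul_sum]
      refine Finset.sum_congr rfl fun j _ => ?_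
      rw [map_mul, rename_C]
      ring
    rw [Finset.sum_congr rfl hR, Finset.sum_comm]
    simp only [← Finset.mul_sum, ← map_sum]
    simp only [← HHF.lap_iter_lin, ← HHF.homog_expand hp0]
    have hexp' : P = ∑ j ∈ Finset.range M, C (cBig (N - n) j) *
        (ySq n N ^ j * rename (HHF.inc hnN) ((lapOn Finset.univ)^[j] (p 0))) := by
      conv_lhs => rw [hexp]
      refine Finset.sum_congr rfl fun j _ => ?_
      rw [show (HHF.phi n N P).coeff (2 * j) = p j from rfl, hsol j, map_mul, rename_C]
      ring
    conv_lhs => rw [hexp']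
    symm
    apply Finset.sum_subset
    · intro j hj
      simp at hj ⊢
      omega
    · intro j _ hj
      simp at hj
      rw [HHF.lap_iter_zero j (p 0) k hp0 (by omega), map_zero, mul_zero, mul_zero]
  · rintro ⟨b, rfl⟩
    refine ⟨∑ K ∈ Finset.Nat.antidiagonalTuple n k, C (b K) *
      ∑ j ∈ Finset.range (k / 2 + 1), C (cBig (N - n) j) *
        ((C (a ^ 2) - ∑ i, X i ^ 2) ^ j * (lapOn Finset.univ)^[j] (∏ i, X i ^ K i)), ?_⟩
    intro z hz
    simp only [map_sum, map_mul]
    refine Finset.sum_congr rfl fun K hK => ?_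
    rw [HHF.Ppoly_eq hnN K (Finset.Nat.mem_antidiagonalTuple.mp hK), map_sum]
    simp only [eval_C]
    congr 1
    refine Finset.sum_congr rfl fun j _ => ?_
    simp only [map_mul, map_pow, map_sub, map_sum, eval_C, eval_X, HHF.eval_ySq hnN, hz, eval_rename]
    rfl
end

section
/- Fix n, N ∈ ℕ with n ≤ N and 2 ≤ N, a > 0 and a multi-index K ∈ ℕ₀^n. Then: (i) P_{N,n,K} is a homogeneous polynomial on ℝ^{N+1} of degree |K|; (ii) P_{N,n,K} is harmonic, i.e. Δ_{ℝ^{N+1}} P_{N,n,K} = 0; (iii) Q_{N,n,K;a}(p^N_n(z)) = P_{N,n,K}(z) for every z ∈ S^N(a). -/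
open MvPolynomial Filter Finset

/-- The polynomial
`Q_{N,n,K;a}(x) = Σ_{j=0}^{⌊|K|/2⌋} C_j(N−n) (a²−|x|₂²)^j Δ^j_{ℝ^n} x^K` on `ℝ^n`. -/
noncomputable def Qpoly (n N : ℕ) (a : ℝ) (K : Fin n → ℕ) : MvPolynomial (Fin n) ℝ :=
  ∑ j ∈ Finset.range ((∑ i, K i) / 2 + 1),
    C (cBig (N - n) j) *
      ((C (a ^ 2) - ∑ i : Fin n, X i ^ 2) ^ j *
        (lapOn (Finset.univ : Finset (Fin n)))^[j] (∏ i : Fin n, X i ^ K i))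

theorem lapOn_sum_aux {σ ι : Type*} [DecidableEq σ] (s : Finset σ) (t : Finset ι)
    (f : ι → MvPolynomial σ ℝ) : lapOn s (∑ j ∈ t, f j) = ∑ j ∈ t, lapOn s (f j) := by
  simp only [lapOn, map_sum]
  exact Finset.sum_comm

theorem lapOn_C_mul_aux {σ : Type*} [DecidableEq σ] (s : Finset σ) (c : ℝ)
    (f : MvPolynomial σ ℝ) : lapOn s (C c * f) = C c * lapOn s f := by
  simp only [lapOn, pderiv_C_mul, Finset.mul_sum]

theorem lapOn_hom_aux {σ : Type*} [DecidableEq σ] (s : Finset σ) (d : ℕ)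
    (f : MvPolynomial σ ℝ) (hf : f.IsHomogeneous d) : (lapOn s f).IsHomogeneous (d - 2) := by
  refine IsHomogeneous.sum _ _ _ fun i _ => ?_
  exact hf.pderiv.pderiv

theorem lapOn_iter_hom_aux {σ : Type*} [DecidableEq σ] (s : Finset σ) (d : ℕ)
    (f : MvPolynomial σ ℝ) (hf : f.IsHomogeneous d) (j : ℕ) :
    ((lapOn s)^[j] f).IsHomogeneous (d - 2 * j) := by
  induction j with
  | zero => simpa using hf
  | succ j ih =>
    rw [Function.iterate_succ_apply']
    exact lapOn_hom_aux s _ _ ih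

theorem lapOn_low_aux {σ : Type*} [DecidableEq σ] (s : Finset σ) (d : ℕ) (hd : d ≤ 1)
    (f : MvPolynomial σ ℝ) (hf : f.IsHomogeneous d) : lapOn s f = 0 := by
  refine Finset.sum_eq_zero fun i _ => ?_
  have h : (pderiv i f).IsHomogeneous (d - 1) := hf.pderiv
  rw [Nat.sub_eq_zero_of_le hd] at h
  rw [totalDegree_eq_zero_iff_eq_C.1 (Nat.le_zero.1 h.totalDegree_le), pderiv_C]

theorem pderiv_rename_aux {σ τ : Type*} (e : σ → τ)
    (he : Function.Injective e) (i : σ) (p : MvPolynomial σ ℝ) :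
    pderiv (e i) (rename e p) = rename e (pderiv i p) := by
  classical
  induction p using MvPolynomial.induction_on with
  | C a => simp
  | add p q hp hq => simp [hp, hq]
  | mul_X p j hp =>
    simp only [map_mul, rename_X, pderiv_mul, hp, map_add, pderiv_X, Pi.single_apply, he.eq_iff]
    split_ifs <;> simp

theorem pderiv_rename_out_aux {σ τ : Type*} (e : σ → τ)
    (i : τ) (hi : ∀ j, e j ≠ i) (p : MvPolynomial σ ℝ) :
    pderiv i (rename e p) = 0 := by
  classical
  induction p using MvPolynomial.induction_on with
  | C a => simp
  | add p q hp hq => simp [hp, hq]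
  | mul_X p j hp => simp [pderiv_mul, hp, pderiv_X_of_ne (hi j)]

theorem filter_lt_aux (n N : ℕ) (h : n ≤ N + 1) :
    Finset.univ.filter (fun i : Fin (N + 1) => (i : ℕ) < n) =
      Finset.univ.map (Fin.castLEEmb h) := by
  ext i
  simp only [Finset.mem_filter, Finset.mem_univ, true_and, Finset.mem_map]
  constructor
  · intro hi
    exact ⟨⟨i, hi⟩, by ext; simp⟩
  · rintro ⟨j, rfl⟩
    simp

theorem lapOn_rename_aux (n N : ℕ) (h : n ≤ N + 1) (p : MvPolynomial (Fin n) ℝ) :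
    lapOn (Finset.univ.filter (fun i : Fin (N + 1) => (i : ℕ) < n)) (rename (Fin.castLE h) p) =
      rename (Fin.castLE h) (lapOn Finset.univ p) := by
  rw [filter_lt_aux n N h]
  simp only [lapOn, Finset.sum_map, map_sum]
  refine Finset.sum_congr rfl fun i _ => ?_
  change pderiv (Fin.castLE h i) (pderiv (Fin.castLE h i) _) = _
  rw [pderiv_rename_aux _ (Fin.castLE_injective h), pderiv_rename_aux _ (Fin.castLE_injective h)]

theorem lapOn_iter_rename_aux (n N : ℕ) (h : n ≤ N + 1) (p : MvPolynomial (Fin n) ℝ) (j : ℕ) :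
    (lapOn (Finset.univ.filter (fun i : Fin (N + 1) => (i : ℕ) < n)))^[j]
        (rename (Fin.castLE h) p) =
      rename (Fin.castLE h) ((lapOn Finset.univ)^[j] p) := by
  induction j with
  | zero => rfl
  | succ j ih => rw [Function.iterate_succ_apply', Function.iterate_succ_apply', ih,
      lapOn_rename_aux]

theorem xPow_eq_aux (n N : ℕ) (h : n ≤ N) (K : Fin n → ℕ) :
    xPow n N h K = rename (Fin.castLE (h.trans (Nat.le_succ N))) (∏ i : Fin n, X i ^ K i) := by
  simp [xPow, map_prod]

theorem pderiv_ySq_lt_aux (n N : ℕ) (i : Fin (N + 1)) (hi : (i : ℕ) < n) :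
    pderiv i (ySq n N) = 0 := by
  rw [ySq, map_sum]
  refine Finset.sum_eq_zero fun j hj => ?_
  have hj' : n ≤ (j : ℕ) := by simpa using hj
  have : j ≠ i := by rintro rfl; omega
  simp [pderiv_pow, pderiv_X_of_ne this]

theorem pderiv_ySq_ge_aux (n N : ℕ) (i : Fin (N + 1)) (hi : n ≤ (i : ℕ)) :
    pderiv i (ySq n N) = 2 * X i := by
  rw [ySq, map_sum, Finset.sum_eq_single i]
  · simp [pderiv_pow]
  · intro j _ hj
    simp [pderiv_pow, pderiv_X_of_ne hj]
  · intro h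
    simp [hi] at h

theorem card_ge_aux (n N : ℕ) (h : n ≤ N) :
    (Finset.univ.filter (fun i : Fin (N + 1) => ¬ (i : ℕ) < n)).card = N - n + 1 := by
  have h1 := Finset.card_filter_add_card_filter_not (s := (Finset.univ : Finset (Fin (N + 1))))
    (fun i : Fin (N + 1) => (i : ℕ) < n)
  rw [filter_lt_aux n N (by omega), Finset.card_map] at h1
  simp only [Finset.card_univ, Fintype.card_fin] at h1
  omega

theorem lap_term_aux (n N : ℕ) (h : n ≤ N) (p : MvPolynomial (Fin n) ℝ) (j : ℕ) :
    lapOn Finset.univ (ySq n N ^ j * rename (Fin.castLE (h.trans (Nat.le_succ N))) p) =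
      ySq n N ^ j * rename (Fin.castLE (h.trans (Nat.le_succ N))) (lapOn Finset.univ p) +
      C (2 * (j : ℝ) * (((N - n : ℕ) : ℝ) + 2 * j - 1)) *
        (ySq n N ^ (j - 1) * rename (Fin.castLE (h.trans (Nat.le_succ N))) p) := by
  set G : MvPolynomial (Fin (N + 1)) ℝ := rename (Fin.castLE (h.trans (Nat.le_succ N))) p with hG
  rw [lapOn, ← Finset.sum_filter_add_sum_filter_not _ (fun i : Fin (N + 1) => (i : ℕ) < n)]
  congr 1
  · rw [← lapOn_rename_aux, lapOn, Finset.mul_sum]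
    refine Finset.sum_congr rfl fun i hi => ?_
    have hi' : (i : ℕ) < n := by simpa using hi
    simp [pderiv_mul, pderiv_pow, pderiv_ySq_lt_aux n N i hi', hG]
  · have hG0 : ∀ i : Fin (N + 1), ¬ (i : ℕ) < n → pderiv i G = 0 := by
      intro i hi
      refine pderiv_rename_out_aux _ i ?_ p
      rintro k rfl
      exact hi (by simp)
    cases j with
    | zero =>
      simp only [pow_zero, one_mul, Nat.cast_zero, mul_zero, zero_mul, C_0]
      refine Finset.sum_eq_zero fun i hi => ?_
      rw [hG0 i (by simpa using hi), map_zero]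
    | succ k =>
      have key : ∀ i ∈ Finset.univ.filter (fun i : Fin (N + 1) => ¬ (i : ℕ) < n),
          pderiv i (pderiv i (ySq n N ^ (k + 1) * G)) =
            (4 * ((k : MvPolynomial (Fin (N + 1)) ℝ) + 1) * (k : MvPolynomial (Fin (N + 1)) ℝ) * ySq n N ^ (k - 1) * G) * X i ^ 2 +
              2 * ((k : MvPolynomial (Fin (N + 1)) ℝ) + 1) * ySq n N ^ k * G := by
        intro i hi
        have hi' : ¬ (i : ℕ) < n := by simpa using hi
        have hn : pderiv i (((k : MvPolynomial (Fin (N + 1)) ℝ)) + 1) = 0 := by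
          rw [map_add, Derivation.map_natCast, pderiv_one, add_zero]
        have h2 : pderiv i (2 : MvPolynomial (Fin (N + 1)) ℝ) = 0 := by
          simpa using Derivation.map_natCast (pderiv (R := ℝ) i) 2
        simp only [pderiv_mul, pderiv_pow, hG0 i hi', pderiv_ySq_ge_aux n N i (not_lt.1 hi'),
          Nat.add_sub_cancel, mul_zero, add_zero, Nat.cast_add, Nat.cast_one, hn, h2,
          pderiv_X_self, zero_mul, zero_add]
        ring
      rw [Finset.sum_congr rfl key, Finset.sum_add_distrib, ← Finset.mul_sum, Finset.sum_const,
        card_ge_aux n N h]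
      have hy : ∑ i ∈ Finset.univ.filter (fun i : Fin (N + 1) => ¬ (i : ℕ) < n),
          (X i : MvPolynomial (Fin (N + 1)) ℝ) ^ 2 = ySq n N := by
        simp only [ySq, not_lt]
      rw [hy]
      have hc : (C (2 * ((k + 1 : ℕ) : ℝ) * (((N - n : ℕ) : ℝ) + 2 * (k + 1 : ℕ) - 1)) :
          MvPolynomial (Fin (N + 1)) ℝ) = 2 * (k + 1) * ((N - n : ℕ) + 2 * (k + 1) - 1) := by
        have hC2 : (C 2 : MvPolynomial (Fin (N + 1)) ℝ) = 2 := map_ofNat C 2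
        simp [hC2]
      rw [hc, Nat.add_sub_cancel, nsmul_eq_mul]
      generalize N - n = m
      cases k with
      | zero => push_cast; ring
      | succ k => rw [Nat.add_sub_cancel]; push_cast; ring

theorem cBig_succ_aux (m j : ℕ) :
    cBig m (j + 1) * (2 * ((j + 1 : ℕ) : ℝ) * ((m : ℝ) + 2 * (j + 1 : ℕ) - 1)) = - cBig m j := by
  rw [cBig, Finset.prod_Icc_succ_top (by omega), ← cBig, cSmall]
  have h1 : ((j + 1 : ℕ) : ℝ) ≠ 0 := by positivity
  have h2 : (m : ℝ) + 2 * (j + 1 : ℕ) - 1 ≠ 0 := by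
    push_cast
    have : (0 : ℝ) < (m : ℝ) + 2 * (j + 1) - 1 := by
      have := Nat.cast_nonneg (α := ℝ) m
      have := Nat.cast_nonneg (α := ℝ) j
      linarith
    exact this.ne'
  field_simp

theorem Ppoly_isHomogeneous_harmonic_and_eq_Qpoly_on_sphere
    (n N : ℕ) (hn : 1 ≤ n) (hnN : n ≤ N) (hN : 2 ≤ N) (a : ℝ) (ha : 0 < a)
    (K : Fin n → ℕ) :
    (Ppoly n N hnN K).IsHomogeneous (∑ i, K i) ∧
    lapOn Finset.univ (Ppoly n N hnN K) = 0 ∧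
    (∀ z : Fin (N + 1) → ℝ, (∑ i, z i ^ 2) = a ^ 2 →
      MvPolynomial.eval (fun i : Fin n => z (Fin.castLE (hnN.trans (Nat.le_succ N)) i))
          (Qpoly n N a K)
        = MvPolynomial.eval z (Ppoly n N hnN K)) := by
  have hmon : (∏ i : Fin n, (X i : MvPolynomial (Fin n) ℝ) ^ K i).IsHomogeneous (∑ i, K i) :=
    IsHomogeneous.prod _ _ _ fun i _ => by simpa using (isHomogeneous_X ℝ i).pow (K i)
  have hP : Ppoly n N hnN K = ∑ j ∈ Finset.range ((∑ i, K i) / 2 + 1),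
      C (cBig (N - n) j) * (ySq n N ^ j * rename (Fin.castLE (hnN.trans (Nat.le_succ N)))
        ((lapOn Finset.univ)^[j] (∏ i : Fin n, X i ^ K i))) := by
    simp only [Ppoly, xPow_eq_aux, lapOn_iter_rename_aux]
  refine ⟨?_, ?_, ?_⟩
  · rw [hP]
    refine IsHomogeneous.sum _ _ _ fun j hj => ?_
    have hj' : j < (∑ i, K i) / 2 + 1 := by simpa using hj
    have hy : (ySq n N).IsHomogeneous 2 :=
      IsHomogeneous.sum _ _ _ fun i _ => by simpa using (isHomogeneous_X ℝ i).pow 2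
    have h1 := ((hy.pow j).mul ((lapOn_iter_hom_aux Finset.univ _ _ hmon j).rename_isHomogeneous
      (f := Fin.castLE (hnN.trans (Nat.le_succ N)))))
    have h2 := (isHomogeneous_C (Fin (N + 1)) (cBig (N - n) j)).mul h1
    convert h2 using 1
    omega
  · have part : ∀ M : ℕ, lapOn Finset.univ (∑ j ∈ Finset.range (M + 1),
        C (cBig (N - n) j) * (ySq n N ^ j * rename (Fin.castLE (hnN.trans (Nat.le_succ N)))
          ((lapOn Finset.univ)^[j] (∏ i : Fin n, X i ^ K i)))) =
        C (cBig (N - n) M) * (ySq n N ^ M * rename (Fin.castLE (hnN.trans (Nat.le_succ N)))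
          ((lapOn Finset.univ)^[M + 1] (∏ i : Fin n, X i ^ K i))) := by
      intro M
      rw [lapOn_sum_aux]
      induction M with
      | zero =>
        rw [Finset.sum_range_one, lapOn_C_mul_aux, lap_term_aux n N hnN]
        simp
      | succ M ih =>
        rw [Finset.sum_range_succ, ih, lapOn_C_mul_aux, lap_term_aux n N hnN, mul_add, ← mul_assoc (C _)
          (C _), ← C_mul, cBig_succ_aux, Nat.add_sub_cancel, C_neg,
          ← Function.iterate_succ_apply' (lapOn Finset.univ)]
        ring
    rw [hP, part, Function.iterate_succ_apply', lapOn_low_aux _ _ _ _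
      (lapOn_iter_hom_aux Finset.univ _ _ hmon _)]
    · simp
    · omega
  · intro z hz
    rw [hP, Qpoly, map_sum, map_sum]
    refine Finset.sum_congr rfl fun j _ => ?_
    simp only [map_mul, map_pow, eval_C, map_sub, map_sum, eval_X, eval_rename, ySq]
    have hs := Finset.sum_filter_add_sum_filter_not Finset.univ
      (fun i : Fin (N + 1) => (i : ℕ) < n) (fun i => z i ^ 2)
    rw [filter_lt_aux n N (hnN.trans (Nat.le_succ N)), Finset.sum_map, hz] at hs
    simp only [not_lt, Fin.castLEEmb_apply] at hs
    rw [← hs, add_sub_cancel_left]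
    rfl
end

section
/- Fix n, N ∈ ℕ with n ≤ N and 2 ≤ N, and k ∈ ℕ₀. The family of polynomials {P_{N,n,K} : K ∈ ℕ₀^n, |K| = k} is linearly independent over ℝ (in the space of polynomials on ℝ^{N+1}). -/
open MvPolynomial Filter Finset

/-- the family `{P_{N,n,K} : |K| = k}` is linearly independent over `ℝ`. -/
theorem Ppoly_linearIndependent
    (n N k : ℕ) (hn : 1 ≤ n) (hnN : n ≤ N) (hN : 2 ≤ N) :
    LinearIndependent ℝ
      (fun K : {K : Fin n → ℕ // (∑ i, K i) = k} => Ppoly n N hnN K.1) := by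
  classical
  let f : MvPolynomial (Fin (N + 1)) ℝ →ₐ[ℝ] MvPolynomial (Fin n) ℝ :=
    aeval (fun i : Fin (N + 1) => if h : (i : ℕ) < n then X ⟨i, h⟩ else 0)
  have hy : f (ySq n N) = 0 := by
    unfold ySq
    rw [map_sum]
    refine Finset.sum_eq_zero fun i hi => ?_
    have h : ¬ (i : ℕ) < n := not_lt.mpr (Finset.mem_filter.mp hi).2
    simp [f, h]
  have hx : ∀ K, f (xPow n N hnN K) = monomial (Finsupp.equivFunOnFinite.symm K) 1 := by
    intro K
    rw [monomial_eq, Finsupp.prod_fintype _ _ (by simp)]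
    simp [xPow, f]
  have hP : ∀ K, f (Ppoly n N hnN K) = monomial (Finsupp.equivFunOnFinite.symm K) 1 := by
    intro K
    unfold Ppoly
    rw [map_sum, Finset.sum_eq_single 0]
    · simp [cBig, hx]
    · intro j _ hj
      simp [hy, hj]
    · simp
  apply LinearIndependent.of_comp f.toLinearMap
  have hb := (basisMonomials (Fin n) ℝ).linearIndependent.comp
    (fun K : {K : Fin n → ℕ // (∑ i, K i) = k} => Finsupp.equivFunOnFinite.symm K.1)
    (Finsupp.equivFunOnFinite.symm.injective.comp Subtype.val_injective)
  have he : (f.toLinearMap ∘ fun K : {K : Fin n → ℕ // (∑ i, K i) = k} => Ppoly n N hnN K.1) =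
      (basisMonomials (Fin n) ℝ) ∘
        (fun K : {K : Fin n → ℕ // (∑ i, K i) = k} => Finsupp.equivFunOnFinite.symm K.1) := by
    funext K
    simp [hP]
  rw [he]
  exact hb
end

section
/- Fix n, N ∈ ℕ with n ≤ N and 2 ≤ N, k ∈ ℕ₀ and a > 0. The real vector space consisting of all homogeneous harmonic polynomials P on ℝ^{N+1} of degree k for which there exists a polynomial Q on ℝ^n with Q(p^N_n(z)) = P(z) for all z ∈ S^N(a) (together with the zero polynomial) has dimension equal to the binomial coefficient C(n−1+k, k), i.e. the number of multi-indices K ∈ ℕ₀^n with |K| = k. -/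
open MvPolynomial Filter Finset

namespace HFP

set_option linter.unusedSectionVars false

variable {σ τ : Type*} [Fintype σ] [DecidableEq σ] [Fintype τ] [DecidableEq τ]

/-- The complement of the range of `ι`. -/
noncomputable def Y (ι : τ → σ) : Finset σ := Finset.univ \ Finset.univ.image ι

/-- The squared length of the complementary variables. -/
noncomputable def W (ι : τ → σ) : MvPolynomial σ ℝ := ∑ i ∈ Y ι, X i ^ 2

theorem mem_Y (ι : τ → σ) (i : σ) : i ∈ Y ι ↔ ¬ ∃ x, ι x = i := by
  simp [Y]

theorem sum_split {M : Type*} [AddCommMonoid M] {ι : τ → σ} (hι : Function.Injective ι)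
    (f : σ → M) : ∑ i, f i = ∑ x, f (ι x) + ∑ i ∈ Y ι, f i := by
  rw [← Finset.sum_image (s := Finset.univ) (g := ι) (f := f) (fun a _ b _ h => hι h), add_comm, Y]
  exact (Finset.sum_sdiff (Finset.subset_univ _)).symm

theorem pderiv_rename_Y {ι : τ → σ} (c : MvPolynomial τ ℝ) {i : σ} (hi : i ∈ Y ι) :
    pderiv i (rename ι c) = 0 := by
  apply pderiv_eq_zero_of_notMem_vars
  intro h
  have := vars_rename ι c h
  rw [Finset.mem_image] at this
  obtain ⟨x, _, hx⟩ := this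
  exact (mem_Y ι i).1 hi ⟨x, hx⟩

theorem pderiv_W_range (ι : τ → σ) (x : τ) : pderiv (ι x) (W ι) = 0 := by
  rw [W, map_sum]
  apply Finset.sum_eq_zero
  intro i hi
  have : i ≠ ι x := fun h => (mem_Y ι i).1 hi ⟨x, h.symm⟩
  rw [pderiv_pow, pderiv_X_of_ne this, mul_zero]

theorem pderiv_W_Y (ι : τ → σ) {i : σ} (hi : i ∈ Y ι) : pderiv i (W ι) = 2 * X i := by
  rw [W, map_sum, Finset.sum_eq_single i]
  · rw [pderiv_pow, pderiv_X_self]; simp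
  · intro j _ hj
    rw [pderiv_pow, pderiv_X_of_ne hj, mul_zero]
  · exact fun h => absurd hi h

theorem lap_add {s : Type*} [Fintype s] [DecidableEq s] (p q : MvPolynomial s ℝ) :
    lapOn Finset.univ (p + q) = lapOn Finset.univ p + lapOn Finset.univ q := by
  simp [lapOn, Finset.sum_add_distrib]

/-- The Laplacian as a linear map. -/
noncomputable def lapL (s : Type*) [Fintype s] [DecidableEq s] :
    MvPolynomial s ℝ →ₗ[ℝ] MvPolynomial s ℝ where
  toFun := lapOn Finset.univ
  map_add' := lap_add
  map_smul' r p := by simp [lapOn, Finset.smul_sum]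

theorem lapL_apply {s : Type*} [Fintype s] [DecidableEq s] (p : MvPolynomial s ℝ) :
    lapL s p = ∑ i, pderiv i (pderiv i p) := rfl

theorem lap_term {ι : τ → σ} (hι : Function.Injective ι) (c : MvPolynomial τ ℝ) (j : ℕ) :
    lapL σ (rename ι c * W ι ^ j) = rename ι (lapL τ c) * W ι ^ j +
      ((2 * j : ℝ) * (2 * j + (Y ι).card - 2)) • (rename ι c * W ι ^ (j - 1)) := by
  rw [lapL_apply, sum_split hι]
  congr 1
  · rw [lapL_apply, map_sum, Finset.sum_mul]
    refine Finset.sum_congr rfl fun x _ => ?_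
    simp [pderiv_W_range, pderiv_rename hι]
    ring
  · have h1 : ∀ i ∈ Y ι, pderiv i (pderiv i (rename ι c * W ι ^ j)) =
        C (2 * j : ℝ) * (rename ι c * W ι ^ (j - 1)) +
        C (4 * j * (j - 1) : ℝ) * (rename ι c * W ι ^ (j - 1 - 1)) * X i ^ 2 := by
      intro i hi
      rcases j with _ | j
      · simp [pderiv_rename_Y c hi]
      · simp [pderiv_W_Y ι hi, pderiv_rename_Y c hi]
        have h2 : (C 2 : MvPolynomial σ ℝ) = 2 := map_ofNat C 2
        have h4 : (C 4 : MvPolynomial σ ℝ) = 4 := map_ofNat C 4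
        have : pderiv i (2 : MvPolynomial σ ℝ) = 0 := by
          rw [← h2, pderiv_C]
        rw [this, h2, h4]
        ring
    have h2 : (C 2 : MvPolynomial σ ℝ) = 2 := map_ofNat C 2
    have h4 : (C 4 : MvPolynomial σ ℝ) = 4 := map_ofNat C 4
    have hW : ∑ i ∈ Y ι, (X i : MvPolynomial σ ℝ) ^ 2 = W ι := rfl
    rw [Finset.sum_congr rfl h1, Finset.sum_add_distrib, Finset.sum_const,
      ← Finset.mul_sum, hW, smul_eq_C_mul, nsmul_eq_mul]
    rcases j with _ | _ | j
    · simp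
    · simp [h2, h4]; ring
    · simp [pow_succ, h2, h4]
      ring

/-- The coefficients of the recursion. -/
noncomputable def β (m j : ℕ) : ℝ := 2 * (j + 1) * (2 * j + m)

theorem β_ne {m : ℕ} (hm : 1 ≤ m) (j : ℕ) : β m j ≠ 0 := by
  have : (1 : ℝ) ≤ m := by exact_mod_cast hm
  unfold β
  positivity

theorem lap_sum {ι : τ → σ} (hι : Function.Injective ι) (c : ℕ → MvPolynomial τ ℝ) (L : ℕ)
    (hL : c L = 0) :
    lapL σ (∑ j ∈ Finset.range L, rename ι (c j) * W ι ^ j) =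
      ∑ j ∈ Finset.range L,
        rename ι (lapL τ (c j) + β (Y ι).card j • c (j + 1)) * W ι ^ j := by
  rw [map_sum, Finset.sum_congr rfl (fun j _ => lap_term hι (c j) j), Finset.sum_add_distrib]
  simp only [map_add, map_smul, add_mul, Finset.sum_add_distrib]
  congr 1
  let g : ℕ → MvPolynomial σ ℝ := fun j =>
    ((2 * j : ℝ) * (2 * j + (Y ι).card - 2)) • (rename ι (c j) * W ι ^ (j - 1))
  have h1 : ∑ j ∈ Finset.range (L + 1), g j = ∑ j ∈ Finset.range L, g j := by
    rw [Finset.sum_range_succ]; simp [g, hL]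
  have h2 : ∑ j ∈ Finset.range (L + 1), g j = ∑ j ∈ Finset.range L, g (j + 1) := by
    rw [Finset.sum_range_succ']; simp [g]
  change ∑ j ∈ Finset.range L, g j = _
  rw [← h1, h2]
  refine Finset.sum_congr rfl fun j _ => ?_
  simp only [g, β, smul_mul_assoc]
  congr 1
  push_cast
  ring

/-- Specialisation: keep the variables in the range, one complementary variable becomes `T`,
the others vanish. -/
noncomputable def φ (ι : τ → σ) (i₀ : σ) :
    MvPolynomial σ ℝ →ₐ[ℝ] Polynomial (MvPolynomial τ ℝ) :=
  aeval (Function.extend ι (fun x => Polynomial.C (X x))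
    (fun i => if i = i₀ then Polynomial.X else 0))

theorem φ_rename {ι : τ → σ} (hι : Function.Injective ι) (i₀ : σ) (c : MvPolynomial τ ℝ) :
    φ ι i₀ (rename ι c) = Polynomial.C c := by
  induction c using MvPolynomial.induction_on with
  | C a =>
    rw [rename_C, φ, aeval_C]
    rfl
  | add p q hp hq => simp [hp, hq]
  | mul_X p x hp => 
    rw [map_mul, map_mul, hp, rename_X, φ, aeval_X, hι.extend_apply, ← map_mul]

theorem φ_X_Y {ι : τ → σ} (i₀ i : σ) (hi : i ∈ Y ι) :
    φ ι i₀ (X i) = if i = i₀ then Polynomial.X else 0 := by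
  rw [φ, aeval_X, Function.extend_apply' _ _ _ ((mem_Y ι i).1 hi)]

theorem φ_W {ι : τ → σ} (i₀ : σ) (h0 : i₀ ∈ Y ι) : φ ι i₀ (W ι) = Polynomial.X ^ 2 := by
  rw [W, map_sum, Finset.sum_eq_single i₀]
  · rw [map_pow, φ_X_Y i₀ i₀ h0, if_pos rfl]
  · intro j hj hne
    rw [map_pow, φ_X_Y i₀ j hj, if_neg hne]; simp
  · exact fun h => absurd h0 h

theorem φ_sum {ι : τ → σ} (hι : Function.Injective ι) (i₀ : σ) (h0 : i₀ ∈ Y ι)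
    (d : ℕ → MvPolynomial τ ℝ) (L j : ℕ) (hj : j < L) :
    (φ ι i₀ (∑ j ∈ Finset.range L, rename ι (d j) * W ι ^ j)).coeff (2 * j) = d j := by
  simp only [map_sum, map_mul, map_pow, φ_rename hι, φ_W i₀ h0, Polynomial.finsetSum_coeff,
    ← pow_mul, Polynomial.coeff_C_mul_X_pow]
  rw [Finset.sum_eq_single j]
  · simp
  · intro b _ hb
    rw [if_neg]; omega
  · intro h; simp at h; omega

theorem eval_φ {ι : τ → σ} (hι : Function.Injective ι) (i₀ : σ) (P : MvPolynomial σ ℝ)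
    (x : τ → ℝ) (t : ℝ) :
    ((φ ι i₀ P).map (eval x)).eval t =
      eval (Function.extend ι x (fun i => if i = i₀ then t else 0)) P := by
  induction P using MvPolynomial.induction_on with
  | C a =>
    rw [φ, aeval_C]
    simp [Polynomial.algebraMap_apply]
  | add p q hp hq => simp [hp, hq]
  | mul_X p i hp => 
    rw [map_mul, map_mul, Polynomial.map_mul, Polynomial.eval_mul, hp, eval_X, φ, aeval_X]
    congr 1
    by_cases h : ∃ y, ι y = i
    · obtain ⟨y, rfl⟩ := h
      simp [hι.extend_apply]
    · rw [Function.extend_apply' _ _ _ h, Function.extend_apply' _ _ _ h]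
      split_ifs <;> simp

theorem eval_hom {k : ℕ} {P : MvPolynomial σ ℝ} (hP : P.IsHomogeneous k) (r : ℝ) (z : σ → ℝ) :
    eval (fun i => r * z i) P = r ^ k * eval z P := by
  rw [eval_eq, eval_eq, Finset.mul_sum]
  refine Finset.sum_congr rfl fun d hd => ?_
  have : ∑ i ∈ d.support, d i = k := hP.degree_eq_sum_deg_support hd |>.symm
  simp only [mul_pow, Finset.prod_mul_distrib, Finset.prod_pow_eq_pow_sum, this]
  ring

theorem finrank_hom (n k : ℕ) (hn : 1 ≤ n) :
    Module.finrank ℝ (homogeneousSubmodule (Fin n) ℝ k) = Nat.choose (n - 1 + k) k := by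
  rw [homogeneousSubmodule_eq_finsupp_supported,
    (AddMonoidAlgebra.supportedEquivFinsupp (R := ℝ) (S := ℝ)
      {d : Fin n →₀ ℕ | d.degree = k}).finrank_eq]
  have e : {d : Fin n →₀ ℕ | d.degree = k} ≃ Sym (Fin n) k :=
    (Equiv.subtypeEquivRight (fun d => by rfl)).trans (Sym.equivNatSum (Fin n) k).symm
  rw [(Finsupp.domLCongr (R := ℝ) (M := ℝ) e).finrank_eq, Module.finrank_finsupp_self,
    Sym.card_sym_eq_choose]
  simp
  congr 1; omega

/-- The coefficients of the harmonic extension. -/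
noncomputable def α (m : ℕ) : ℕ → ℝ
  | 0 => 1
  | j + 1 => -(α m j) / β m j

/-- The harmonic extension map. -/
noncomputable def E (ι : τ → σ) (k : ℕ) : MvPolynomial τ ℝ →ₗ[ℝ] MvPolynomial σ ℝ where
  toFun q := ∑ j ∈ Finset.range (k + 1),
    rename ι (α (Y ι).card j • (lapL τ ^ j) q) * W ι ^ j
  map_add' p q := by
    simp only [map_add, smul_add, add_mul, Finset.sum_add_distrib]
  map_smul' r p := by
    simp only [map_smul, smul_mul_assoc, Finset.smul_sum, RingHom.id_apply]
    exact Finset.sum_congr rfl fun j _ => smul_comm _ _ _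

theorem E_apply (ι : τ → σ) (k : ℕ) (q : MvPolynomial τ ℝ) :
    E ι k q = ∑ j ∈ Finset.range (k + 1),
      rename ι (α (Y ι).card j • (lapL τ ^ j) q) * W ι ^ j := rfl

theorem lap_low {k : ℕ} {p : MvPolynomial τ ℝ} (hp : p.IsHomogeneous k) (hk : k < 2) :
    lapL τ p = 0 := by
  rw [lapL_apply]
  refine Finset.sum_eq_zero fun i _ => ?_
  have h : (pderiv i p).IsHomogeneous 0 := by
    have := hp.pderiv (i := i)
    rwa [show k - 1 = 0 by omega] at this
  rw [totalDegree_eq_zero_iff_eq_C.1 ((totalDegree_zero_iff_isHomogeneous _).2 h), pderiv_C]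

theorem lap_hom {k : ℕ} {p : MvPolynomial τ ℝ} (hp : p.IsHomogeneous k) :
    (lapL τ p).IsHomogeneous (k - 2) := by
  rw [lapL_apply]
  refine IsHomogeneous.sum _ _ _ fun i _ => ?_
  exact (hp.pderiv (i := i)).pderiv (i := i)

theorem lap_pow {k : ℕ} {p : MvPolynomial τ ℝ} (hp : p.IsHomogeneous k) (j : ℕ) :
    ((lapL τ ^ j) p).IsHomogeneous (k - 2 * j) ∧ (k < 2 * j → (lapL τ ^ j) p = 0) := by
  induction j with
  | zero => simpa using hp
  | succ j ih =>
    rw [pow_succ', Module.End.mul_apply]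
    constructor
    · have := lap_hom ih.1
      rwa [show k - 2 * j - 2 = k - 2 * (j + 1) by omega] at this
    · intro h
      by_cases h' : k < 2 * j
      · rw [ih.2 h', map_zero]
      · exact lap_low ih.1 (by omega)

theorem W_hom (ι : τ → σ) : (W ι).IsHomogeneous 2 :=
  IsHomogeneous.sum _ _ _ fun i _ => isHomogeneous_X_pow i 2

theorem E_hom (ι : τ → σ) {k : ℕ} {q : MvPolynomial τ ℝ} (hq : q.IsHomogeneous k) :
    (E ι k q).IsHomogeneous k := by
  rw [E_apply]
  refine IsHomogeneous.sum _ _ _ fun j _ => ?_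
  by_cases h : k < 2 * j
  · rw [(lap_pow hq j).2 h]
    simpa using isHomogeneous_zero σ ℝ k
  · have h1 : (α (Y ι).card j • (lapL τ ^ j) q).IsHomogeneous (k - 2 * j) := by
      rw [smul_eq_C_mul]
      exact (lap_pow hq j).1.C_mul _
    have := (h1.rename_isHomogeneous (f := ι)).mul ((W_hom ι).pow j)
    rwa [show k - 2 * j + 2 * j = k by omega] at this

theorem E_harm {ι : τ → σ} (hι : Function.Injective ι) (hm : 1 ≤ (Y ι).card)
    {k : ℕ} {q : MvPolynomial τ ℝ} (hq : q.IsHomogeneous k) : lapL σ (E ι k q) = 0 := by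
  rw [E_apply, lap_sum hι (fun j => α (Y ι).card j • (lapL τ ^ j) q)]
  · refine Finset.sum_eq_zero fun j _ => ?_
    have : lapL τ (α (Y ι).card j • (lapL τ ^ j) q) +
        β (Y ι).card j • (α (Y ι).card (j + 1) • (lapL τ ^ (j + 1)) q) = 0 := by
      rw [map_smul, smul_smul, pow_succ', Module.End.mul_apply, ← add_smul, α]
      rw [mul_div_cancel₀ _ (β_ne hm j)]
      simp
    rw [this]; simp
  · rw [(lap_pow hq (k + 1)).2 (by omega), smul_zero]

theorem eval_W (ι : τ → σ) (z : σ → ℝ) : eval z (W ι) = ∑ i ∈ Y ι, z i ^ 2 := by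
  simp [W]

theorem E_factor {ι : τ → σ} (hι : Function.Injective ι) (k : ℕ) (q : MvPolynomial τ ℝ) (a : ℝ) :
    ∃ Q : MvPolynomial τ ℝ, ∀ z : σ → ℝ, (∑ i, z i ^ 2) = a ^ 2 →
      eval (fun x => z (ι x)) Q = eval z (E ι k q) := by
  refine ⟨∑ j ∈ Finset.range (k + 1), (α (Y ι).card j • (lapL τ ^ j) q) *
    (C (a ^ 2) - ∑ x, X x ^ 2) ^ j, fun z hz => ?_⟩
  rw [sum_split hι] at hz
  rw [E_apply, map_sum, map_sum]
  refine Finset.sum_congr rfl fun j _ => ?_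
  rw [map_mul, map_mul, map_pow (eval _) _ j, map_pow (eval _) _ j, eval_W, eval_rename]
  congr 2
  simp only [map_sub, map_sum, map_pow, eval_C, eval_X]
  linarith

theorem E_inj {ι : τ → σ} (hι : Function.Injective ι) (i₀ : σ) (h0 : i₀ ∈ Y ι) (k : ℕ) :
    Function.Injective (E ι k) := by
  intro p q h
  have hp := φ_sum hι i₀ h0 (fun j => α (Y ι).card j • (lapL τ ^ j) p) (k + 1) 0 (by omega)
  have hq := φ_sum hι i₀ h0 (fun j => α (Y ι).card j • (lapL τ ^ j) q) (k + 1) 0 (by omega)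
  rw [← E_apply] at hp hq
  rw [h, hq] at hp
  simpa [α] using hp.symm

/-- Invariance of `P` under the motions preserving the projection. -/
theorem invar {ι : τ → σ} {k : ℕ} {P : MvPolynomial σ ℝ}
    (hP : P.IsHomogeneous k) {a : ℝ} (ha : 0 < a) (Q : MvPolynomial τ ℝ)
    (hQ : ∀ z : σ → ℝ, (∑ i, z i ^ 2) = a ^ 2 → eval (fun x => z (ι x)) Q = eval z P)
    (z w : σ → ℝ) (hx : ∀ x, z (ι x) = w (ι x)) (hs : ∑ i, z i ^ 2 = ∑ i, w i ^ 2) :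
    eval z P = eval w P := by
  by_cases h0 : ∑ i, w i ^ 2 = 0
  · have hw := (Finset.sum_eq_zero_iff_of_nonneg (fun i _ => sq_nonneg (w i))).1 h0
    have hz := (Finset.sum_eq_zero_iff_of_nonneg (fun i _ => sq_nonneg (z i))).1 (hs.trans h0)
    congr 2
    funext i
    rw [pow_eq_zero_iff two_ne_zero |>.1 (hw i (Finset.mem_univ _)),
      pow_eq_zero_iff two_ne_zero |>.1 (hz i (Finset.mem_univ _))]
  · have hpos : 0 < ∑ i, w i ^ 2 :=
      lt_of_le_of_ne (Finset.sum_nonneg fun i _ => sq_nonneg (w i)) (Ne.symm h0)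
    set s := ∑ i, w i ^ 2 with hsdef
    set r := a / Real.sqrt s with hr
    have hsq : 0 < Real.sqrt s := Real.sqrt_pos.2 hpos
    have hr0 : 0 < r := by positivity
    have hrs : r ^ 2 * s = a ^ 2 := by
      rw [hr, div_pow, Real.sq_sqrt hpos.le]; field_simp
    have h1 := hQ (fun i => r * z i) (by simp only [mul_pow, ← Finset.mul_sum]; rw [hs, hrs])
    have h2 := hQ (fun i => r * w i) (by simp only [mul_pow, ← Finset.mul_sum]; rw [← hsdef, hrs])
    simp only [hx] at h1
    rw [h1, eval_hom hP, eval_hom hP] at h2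
    exact mul_left_cancel₀ (pow_ne_zero k hr0.ne') h2

theorem even_coeff (f : Polynomial ℝ) (hf : ∀ t, f.eval t = f.eval (-t)) (l : ℕ) (hl : Odd l) :
    f.coeff l = 0 := by
  have h : f = f.comp (Polynomial.C (-1) * Polynomial.X) := by
    apply Polynomial.funext
    intro t
    rw [Polynomial.eval_comp]
    simpa using hf t
  have h2 := congrArg (fun g => Polynomial.coeff g l) h
  simp only [Polynomial.comp_C_mul_X_coeff, hl.neg_one_pow] at h2
  linarith

theorem eval_even (f : Polynomial ℝ) (hf : ∀ t, f.eval t = f.eval (-t)) (L : ℕ)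
    (hL : f.natDegree < L) (t : ℝ) :
    f.eval t = ∑ j ∈ Finset.range L, f.coeff (2 * j) * (t ^ 2) ^ j := by
  rw [Polynomial.eval_eq_sum_range' (n := 2 * L) (by omega)]
  have key : ∀ M : ℕ, ∑ i ∈ Finset.range (2 * M), f.coeff i * t ^ i =
      ∑ j ∈ Finset.range M, f.coeff (2 * j) * (t ^ 2) ^ j := by
    intro M
    induction M with
    | zero => simp
    | succ M ih =>
      rw [show 2 * (M + 1) = 2 * M + 1 + 1 by ring, Finset.sum_range_succ, Finset.sum_range_succ,
        Finset.sum_range_succ, ih, even_coeff f hf (2 * M + 1) ⟨M, rfl⟩, pow_mul]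
      simp
  exact key L

theorem decomp {ι : τ → σ} (hι : Function.Injective ι) (i₀ : σ) (h0 : i₀ ∈ Y ι)
    {k : ℕ} {P : MvPolynomial σ ℝ}
    (hP : P.IsHomogeneous k) {a : ℝ} (ha : 0 < a) (Q : MvPolynomial τ ℝ)
    (hQ : ∀ z : σ → ℝ, (∑ i, z i ^ 2) = a ^ 2 → eval (fun x => z (ι x)) Q = eval z P)
    (L : ℕ) (hL : (φ ι i₀ P).natDegree < L) :
    P = ∑ j ∈ Finset.range L, rename ι ((φ ι i₀ P).coeff (2 * j)) * W ι ^ j := by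
  have hsum : ∀ (x : τ → ℝ) (t : ℝ),
      ∑ i, (Function.extend ι x (fun i => if i = i₀ then t else 0)) i ^ 2 =
        ∑ y, x y ^ 2 + t ^ 2 := by
    intro x t
    rw [sum_split hι]
    congr 1
    · simp [hι.extend_apply]
    · rw [Finset.sum_eq_single i₀]
      · rw [Function.extend_apply' _ _ _ ((mem_Y ι i₀).1 h0), if_pos rfl]
      · intro j hj hne
        rw [Function.extend_apply' _ _ _ ((mem_Y ι j).1 hj), if_neg hne]
        simp
      · exact fun h => absurd h0 h
  apply MvPolynomial.funext
  intro z
  set x : τ → ℝ := fun y => z (ι y) with hxdef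
  set f := (φ ι i₀ P).map (eval x) with hfdef
  have hf : ∀ t, f.eval t = f.eval (-t) := by
    intro t
    rw [hfdef, eval_φ hι, eval_φ hι]
    refine invar hP ha Q hQ _ _ (fun y => ?_) ?_
    · rw [hι.extend_apply, hι.extend_apply]
    · rw [hsum, hsum]; ring
  set t := Real.sqrt (∑ i ∈ Y ι, z i ^ 2) with htdef
  have ht : t ^ 2 = ∑ i ∈ Y ι, z i ^ 2 :=
    Real.sq_sqrt (Finset.sum_nonneg fun i _ => sq_nonneg _)
  have h1 : eval z P = f.eval t := by
    rw [hfdef, eval_φ hι]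
    refine invar hP ha Q hQ _ _ (fun y => ?_) ?_
    · rw [hι.extend_apply]
    · rw [hsum, ht, sum_split hι]
  rw [h1, eval_even f hf L (lt_of_le_of_lt Polynomial.natDegree_map_le hL), map_sum]
  refine Finset.sum_congr rfl fun j _ => ?_
  rw [map_mul, map_pow, eval_W, ht, eval_rename, hfdef, Polynomial.coeff_map]
  rfl

theorem coeff_zero_hom {ι : τ → σ} (hι : Function.Injective ι) (i₀ : σ)
    {k : ℕ} {P : MvPolynomial σ ℝ} (hP : P.IsHomogeneous k) :
    ((φ ι i₀ P).coeff 0).IsHomogeneous k := by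
  have h : (φ ι i₀ P).coeff 0 = aeval (Function.extend ι (fun x => (X x : MvPolynomial τ ℝ))
      (fun _ => 0)) P := by
    clear hP
    induction P using MvPolynomial.induction_on with
    | C r =>
      rw [φ, aeval_C, aeval_C]
      simp [Polynomial.algebraMap_apply]
    | add p q hp hq => simp [hp, hq]
    | mul_X p i hp =>
      rw [map_mul, map_mul, Polynomial.mul_coeff_zero, hp, φ, aeval_X, aeval_X]
      congr 1
      by_cases h : ∃ y, ι y = i
      · obtain ⟨y, rfl⟩ := h
        simp [hι.extend_apply]
      · rw [Function.extend_apply' _ _ _ h, Function.extend_apply' _ _ _ h]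
        split_ifs <;> simp
  rw [h]
  have := hP.aeval (n := 1) (Function.extend ι (fun x => (X x : MvPolynomial τ ℝ))
      (fun _ => 0)) (by
    intro i
    by_cases h : ∃ y, ι y = i
    · obtain ⟨y, rfl⟩ := h
      rw [hι.extend_apply]
      exact isHomogeneous_X _ _
    · rw [Function.extend_apply' _ _ _ h]
      exact isHomogeneous_zero _ _ _)
  rwa [one_mul] at this

theorem eq_E {ι : τ → σ} (hι : Function.Injective ι) (i₀ : σ) (h0 : i₀ ∈ Y ι)
    {k : ℕ} {P : MvPolynomial σ ℝ}
    (hP : P.IsHomogeneous k) (hharm : lapL σ P = 0) {a : ℝ} (ha : 0 < a) (Q : MvPolynomial τ ℝ)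
    (hQ : ∀ z : σ → ℝ, (∑ i, z i ^ 2) = a ^ 2 → eval (fun x => z (ι x)) Q = eval z P) :
    P = E ι k ((φ ι i₀ P).coeff 0) := by
  have hm : 1 ≤ (Y ι).card := Finset.card_pos.2 ⟨i₀, h0⟩
  set c : ℕ → MvPolynomial τ ℝ := fun j => (φ ι i₀ P).coeff (2 * j) with hc
  set L := (φ ι i₀ P).natDegree + k + 1 with hL
  have hdec := decomp hι i₀ h0 hP ha Q hQ L (by omega)
  have hcL : ∀ j, L ≤ j → c j = 0 := fun j hj =>
    Polynomial.coeff_eq_zero_of_natDegree_lt (by omega)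
  have hlap := lap_sum hι c L (hcL L le_rfl)
  rw [← hdec, hharm] at hlap
  have hrec : ∀ j, j < L → lapL τ (c j) + β (Y ι).card j • c (j + 1) = 0 := by
    intro j hj
    have := φ_sum hι i₀ h0 (fun j => lapL τ (c j) + β (Y ι).card j • c (j + 1)) L j hj
    rw [← hlap] at this
    simpa using this.symm
  have hform : ∀ j, j < L → c j = α (Y ι).card j • (lapL τ ^ j) (c 0) := by
    intro j
    induction j with
    | zero => intro _; simp [α]
    | succ j ih =>
      intro hj
      have h1 := hrec j (by omega)
      rw [ih (by omega), map_smul] at h1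
      have h2 : β (Y ι).card j • c (j + 1) =
          -(α (Y ι).card j • lapL τ ((lapL τ ^ j) (c 0))) := eq_neg_of_add_eq_zero_right h1
      have h3 : c (j + 1) = (β (Y ι).card j)⁻¹ • (β (Y ι).card j • c (j + 1)) := by
        rw [smul_smul, inv_mul_cancel₀ (β_ne hm j), one_smul]
      rw [h3, h2, α, pow_succ', Module.End.mul_apply, ← neg_smul, smul_smul]
      congr 1
      ring
  have hc0 : (c 0).IsHomogeneous k := coeff_zero_hom hι i₀ hP
  change P = E ι k (c 0)
  rw [E_apply]
  conv_lhs => rw [hdec]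
  symm
  rw [Finset.sum_congr rfl (fun j hj => by
    rw [← hform j (by rw [Finset.mem_range] at hj; omega)])]
  apply Finset.sum_subset
  · intro j hj
    rw [Finset.mem_range] at *
    omega
  · intro j hj hj'
    rw [Finset.mem_range] at *
    rw [hform j hj, (lap_pow hc0 j).2 (by omega)]
    simp

end HFP

/-- the space of homogeneous harmonic polynomials of degree `k` on `ℝ^{N+1}` that
factor through the projection onto the first `n` coordinates on the sphere `S^N(a)` (together
with the zero polynomial) has dimension `C(n-1+k, k)`. -/
theorem finrank_harmonic_factoring_through_projection
    (n N k : ℕ) (hn : 1 ≤ n) (hnN : n ≤ N) (hN : 2 ≤ N) (a : ℝ) (ha : 0 < a) :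
    Set.finrank ℝ
      {P : MvPolynomial (Fin (N + 1)) ℝ |
        (P.IsHomogeneous k ∧ lapOn Finset.univ P = 0 ∧
          ∃ Q : MvPolynomial (Fin n) ℝ, ∀ z : Fin (N + 1) → ℝ, (∑ i, z i ^ 2) = a ^ 2 →
            MvPolynomial.eval (fun i : Fin n => z (Fin.castLE (hnN.trans (Nat.le_succ N)) i)) Q
              = MvPolynomial.eval z P) ∨ P = 0}
      = Nat.choose (n - 1 + k) k := by
  set ι : Fin n → Fin (N + 1) := Fin.castLE (hnN.trans (Nat.le_succ N)) with hιdef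
  have hι : Function.Injective ι := Fin.castLE_injective _
  have h0 : Fin.last N ∈ HFP.Y ι := by
    rw [HFP.mem_Y]
    rintro ⟨x, hx⟩
    have h1 := congrArg Fin.val hx
    have h2 : (ι x : ℕ) = x := rfl
    rw [h2, Fin.val_last] at h1
    omega
  have hset : {P : MvPolynomial (Fin (N + 1)) ℝ |
        (P.IsHomogeneous k ∧ lapOn Finset.univ P = 0 ∧
          ∃ Q : MvPolynomial (Fin n) ℝ, ∀ z : Fin (N + 1) → ℝ, (∑ i, z i ^ 2) = a ^ 2 →
            MvPolynomial.eval (fun i : Fin n => z (ι i)) Q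
              = MvPolynomial.eval z P) ∨ P = 0} =
      ((homogeneousSubmodule (Fin n) ℝ k).map (HFP.E ι k) : Set (MvPolynomial (Fin (N + 1)) ℝ)) := by
    ext P
    constructor
    · rintro (⟨hP, hh, Q, hQ⟩ | rfl)
      · exact ⟨_, HFP.coeff_zero_hom hι (Fin.last N) hP,
          (HFP.eq_E hι (Fin.last N) h0 hP hh ha Q hQ).symm⟩
      · exact Submodule.zero_mem _
    · rintro ⟨q, hq, rfl⟩
      have hq' : q.IsHomogeneous k := hq
      exact Or.inl ⟨HFP.E_hom ι hq', HFP.E_harm hι (Finset.card_pos.2 ⟨_, h0⟩) hq',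
        HFP.E_factor hι k q a⟩
  rw [hset, Set.finrank, Submodule.span_eq,
    ← (Submodule.equivMapOfInjective (HFP.E ι k) (HFP.E_inj hι _ h0 k) _).finrank_eq,
    HFP.finrank_hom n k hn]
end

section
/- Fix n ∈ ℕ, α > 0 and a multi-index K ∈ ℕ₀^n with |K| = k. Then the polynomial Q_{n,K;α} satisfies the Ornstein–Uhlenbeck eigenvalue equation Δ_{ℝ^n} Q_{n,K;α}(x) − α^{−2} ⟨x, ∇ Q_{n,K;α}(x)⟩ = −(k/α²) Q_{n,K;α}(x) for all x ∈ ℝ^n. -/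
open MvPolynomial Filter Finset

/-- The polynomial `Q_{n,K;α}(x) = Σ_{j=0}^{⌊|K|/2⌋} (−1)^j (α^{2j}/(2^j j!)) Δ^j_{ℝ^n} x^K`. -/
noncomputable def Qlim (n : ℕ) (α : ℝ) (K : Fin n → ℕ) : MvPolynomial (Fin n) ℝ :=
  ∑ j ∈ Finset.range ((∑ i, K i) / 2 + 1),
    C ((-1 : ℝ) ^ j * α ^ (2 * j) / (2 ^ j * (Nat.factorial j))) *
      (lapOn (Finset.univ : Finset (Fin n)))^[j] (∏ i : Fin n, X i ^ K i)

/-- The iterated Laplacian of the monomial is homogeneous of degree `k - 2 j`. -/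
lemma lap_iter_isHomogeneous {n : ℕ} (K : Fin n → ℕ) (j : ℕ) :
    ((lapOn (Finset.univ : Finset (Fin n)))^[j] (∏ i : Fin n, X i ^ K i)).IsHomogeneous
      ((∑ i, K i) - 2 * j) := by
  induction j with
  | zero =>
    simp only [Function.iterate_zero, id, mul_zero, Nat.sub_zero]
    exact IsHomogeneous.prod _ _ _ (fun i _ => isHomogeneous_X_pow i (K i))
  | succ j ih =>
    rw [Function.iterate_succ_apply']
    unfold lapOn at ih ⊢
    have e : (∑ i, K i) - 2 * (j + 1) = (∑ i, K i) - 2 * j - 1 - 1 := by omega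
    rw [e]
    exact IsHomogeneous.sum _ _ _ (fun i _ => ih.pderiv.pderiv)

/-- The Laplacian kills homogeneous polynomials of degree at most one. -/
lemma lap_eq_zero {n d : ℕ} (p : MvPolynomial (Fin n) ℝ) (hp : p.IsHomogeneous d) (hd : d ≤ 1) :
    lapOn Finset.univ p = 0 := by
  unfold lapOn
  refine Finset.sum_eq_zero fun i _ => ?_
  have h : (pderiv i p).IsHomogeneous (d - 1) := hp.pderiv
  rw [show d - 1 = 0 by omega, ← totalDegree_zero_iff_isHomogeneous,
    totalDegree_eq_zero_iff_eq_C] at h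
  rw [h, pderiv_C]

lemma lapOn_sum_C_mul {n : ℕ} (s : Finset ℕ) (c : ℕ → ℝ) (P : ℕ → MvPolynomial (Fin n) ℝ) :
    lapOn Finset.univ (∑ j ∈ s, C (c j) * P j) = ∑ j ∈ s, C (c j) * lapOn Finset.univ (P j) := by
  unfold lapOn
  simp only [map_sum, pderiv_C_mul, Finset.mul_sum, ← C_mul', smul_eq_C_mul]
  rw [Finset.sum_comm]

/-- `Q_{n,K;α}` satisfies the Ornstein–Uhlenbeck eigenvalue equation
`Δ Q(x) − α⁻² ⟨x, ∇Q(x)⟩ = −(k/α²) Q(x)` for all `x ∈ ℝ^n`, where `k = |K|`. -/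
theorem Qlim_ornsteinUhlenbeck_eigenfunction
    (n k : ℕ) (hn : 1 ≤ n) (α : ℝ) (hα : 0 < α) (K : Fin n → ℕ) (hK : (∑ i, K i) = k) :
    ∀ x : Fin n → ℝ,
      MvPolynomial.eval x (lapOn Finset.univ (Qlim n α K))
          - (α ^ 2)⁻¹ * ∑ i : Fin n, x i * MvPolynomial.eval x (pderiv i (Qlim n α K))
        = -((k : ℝ) / α ^ 2) * MvPolynomial.eval x (Qlim n α K) := by
  intro x
  subst hK
  set k := ∑ i, K i with hk
  set P : ℕ → MvPolynomial (Fin n) ℝ :=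
    fun j => (lapOn (Finset.univ : Finset (Fin n)))^[j] (∏ i : Fin n, X i ^ K i) with hP
  set c : ℕ → ℝ := fun j => (-1 : ℝ) ^ j * α ^ (2 * j) / (2 ^ j * (Nat.factorial j)) with hc
  have hQ : Qlim n α K = ∑ j ∈ Finset.range (k / 2 + 1), C (c j) * P j := rfl
  have hPs : ∀ j, lapOn Finset.univ (P j) = P (j + 1) := fun j => by
    simp only [hP, Function.iterate_succ_apply']
  have hhom : ∀ j, (P j).IsHomogeneous (k - 2 * j) := lap_iter_isHomogeneous K
  have hlast : P (k / 2 + 1) = 0 := by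
    rw [← hPs]
    exact lap_eq_zero _ (hhom _) (by omega)
  have hE : ∀ j ∈ Finset.range (k / 2 + 1),
      ∑ i, x i * eval x (pderiv i (P j)) = ((k : ℝ) - 2 * j) * eval x (P j) := by
    intro j hj
    have hj' : 2 * j ≤ k := by
      have := Finset.mem_range.mp hj
      omega
    have h := congrArg (eval x) (hhom j).sum_X_mul_pderiv
    simp only [map_sum, map_mul, eval_X, nsmul_eq_mul, map_natCast] at h
    rw [h, Nat.cast_sub hj']
    push_cast
    ring
  have hEQ : ∑ i, x i * eval x (pderiv i (Qlim n α K)) =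
      ∑ j ∈ Finset.range (k / 2 + 1), c j * (((k : ℝ) - 2 * j) * eval x (P j)) := by
    rw [← Finset.sum_congr rfl (fun j hj => congrArg (c j * ·) (hE j hj)), hQ]
    simp only [map_sum, pderiv_C_mul, smul_eval, Finset.mul_sum]
    rw [Finset.sum_comm]
    refine Finset.sum_congr rfl fun j _ => Finset.sum_congr rfl fun i _ => ?_
    simp only [map_mul, eval_C]
    ring
  have hcs : ∀ j, c j = -(2 * ((j + 1 : ℕ) : ℝ) * (α ^ 2)⁻¹ * c (j + 1)) := by
    intro j
    simp only [hc, Nat.factorial_succ]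
    have hf : (Nat.factorial j : ℝ) ≠ 0 := by exact_mod_cast Nat.factorial_ne_zero j
    have hj : ((j : ℝ) + 1) ≠ 0 := by positivity
    have ha : α ≠ 0 := hα.ne'
    push_cast
    field_simp
    ring
  have htel := Finset.sum_range_sub
    (fun j : ℕ => 2 * (j : ℝ) * (α ^ 2)⁻¹ * c j * eval x (P j)) (k / 2 + 1)
  simp only [hlast, map_zero, mul_zero, Nat.cast_zero, zero_mul, sub_zero] at htel
  rw [hEQ, hQ, lapOn_sum_C_mul]
  simp only [hPs, map_sum, map_mul, eval_C]
  rw [← sub_eq_zero, Finset.mul_sum, Finset.mul_sum, ← Finset.sum_sub_distrib,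
    ← Finset.sum_sub_distrib, ← neg_eq_zero, ← Finset.sum_neg_distrib, ← htel]
  refine Finset.sum_congr rfl fun j _ => ?_
  have h := hcs j
  linear_combination (-eval x (P (j + 1))) * h
end

section
/- Fix n ∈ ℕ, α > 0 and a multi-index K ∈ ℕ₀^n, and let {a_N}_{N ≥ max(n,2)} be positive reals with a_N/√(N−1) → α as N → ∞. Then the polynomials Q_{N,n,K;a_N} converge to Q_{n,K;α} uniformly on every compact subset of ℝ^n as N → ∞. -/
open MvPolynomial Filter Finset

lemma cSmall_scaled_tendsto (n l : ℕ) (hl : 1 ≤ l) :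
    Tendsto (fun N : ℕ => cSmall (N - n) l * ((N : ℝ) - 1)) atTop (nhds (-1 / (2 * l))) := by
  have hl0 : (l : ℝ) ≠ 0 := by positivity
  have h1 : Tendsto (fun N : ℕ => (N : ℝ) + (2 * l - 1 - n)) atTop atTop :=
    tendsto_atTop_add_const_right _ _ tendsto_natCast_atTop_atTop
  have h2 : Tendsto (fun N : ℕ => -1 / (2 * (l : ℝ)) *
      (1 - (2 * l - n) * ((N : ℝ) + (2 * l - 1 - n))⁻¹)) atTop
      (nhds (-1 / (2 * (l : ℝ)) * (1 - (2 * l - n) * 0))) :=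
    (((tendsto_inv_atTop_zero.comp h1).const_mul _).const_sub _).const_mul _
  simp only [mul_zero, sub_zero, mul_one] at h2
  refine h2.congr' ?_
  filter_upwards [eventually_ge_atTop n, h1.eventually_gt_atTop 0] with N hN hp
  have e : ((N - n : ℕ) : ℝ) + 2 * l - 1 = (N : ℝ) + (2 * l - 1 - n) := by
    rw [Nat.cast_sub hN]; ring
  unfold cSmall
  rw [e]
  have := hp.ne'
  generalize hd : (N : ℝ) + (2 * l - 1 - n) = d at *
  have hN' : (N : ℝ) = d - (2 * l - 1 - n) := by rw [← hd]; ring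
  rw [hN']
  field_simp
  ring

lemma cSmall_tendsto_zero (n l : ℕ) (hl : 1 ≤ l) :
    Tendsto (fun N : ℕ => cSmall (N - n) l) atTop (nhds 0) := by
  have h1 : Tendsto (fun N : ℕ => (N : ℝ) + (- 1)) atTop atTop :=
    tendsto_atTop_add_const_right _ _ tendsto_natCast_atTop_atTop
  have h2 := (cSmall_scaled_tendsto n l hl).mul (tendsto_inv_atTop_zero.comp h1)
  rw [mul_zero] at h2
  refine h2.congr' ?_
  filter_upwards [h1.eventually_gt_atTop 0] with N hp
  have : (N : ℝ) - 1 ≠ 0 := by linarith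
  simp only [Function.comp, ← sub_eq_add_neg]
  field_simp

lemma cSmall_sq_tendsto (n l : ℕ) (hl : 1 ≤ l) (α : ℝ) (a : ℕ → ℝ)
    (hlim : Tendsto (fun N : ℕ => a N / Real.sqrt ((N : ℝ) - 1)) atTop (nhds α)) :
    Tendsto (fun N : ℕ => cSmall (N - n) l * a N ^ 2) atTop (nhds (-1 / (2 * l) * α ^ 2)) := by
  refine ((cSmall_scaled_tendsto n l hl).mul (hlim.pow 2)).congr' ?_
  filter_upwards [eventually_gt_atTop 1] with N hN
  have hp : (0 : ℝ) < (N : ℝ) - 1 := by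
    have : (1 : ℝ) < N := by exact_mod_cast hN
    linarith
  rw [div_pow, Real.sq_sqrt hp.le]
  field_simp

lemma prod_limit (α : ℝ) (j : ℕ) :
    ∏ l ∈ Finset.Icc 1 j, (-1 / (2 * (l : ℝ)) * α ^ 2) =
      (-1 : ℝ) ^ j * α ^ (2 * j) / (2 ^ j * (Nat.factorial j)) := by
  induction j with
  | zero => simp
  | succ j ih =>
    rw [Finset.prod_Icc_succ_top (by omega), ih, Nat.factorial_succ]
    have : (Nat.factorial j : ℝ) ≠ 0 := by positivity
    push_cast
    field_simp
    ring

/-- if `a_N/√(N−1) → α`, the polynomials `Q_{N,n,K;a_N}` converge to `Q_{n,K;α}`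
uniformly on every compact subset of `ℝ^n`. -/
theorem Qpoly_tendstoUniformlyOn_compacts
    (n : ℕ) (hn : 1 ≤ n) (α : ℝ) (hα : 0 < α) (K : Fin n → ℕ) (a : ℕ → ℝ)
    (ha : ∀ N, max n 2 ≤ N → 0 < a N)
    (hlim : Tendsto (fun N : ℕ => a N / Real.sqrt ((N : ℝ) - 1)) atTop (nhds α)) :
    ∀ s : Set (Fin n → ℝ), IsCompact s →
      TendstoUniformlyOn (fun (N : ℕ) (x : Fin n → ℝ) => MvPolynomial.eval x (Qpoly n N (a N) K))
        (fun x => MvPolynomial.eval x (Qlim n α K)) atTop s := by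
  intro s hs
  rw [← tendstoLocallyUniformlyOn_iff_tendstoUniformlyOn_of_compact hs,
    tendstoLocallyUniformlyOn_iff_forall_tendsto]
  intro x hx
  have hsnd : Tendsto (fun z : ℕ × (Fin n → ℝ) => z.2) (atTop ×ˢ nhdsWithin x s) (nhds x) :=
    tendsto_snd.mono_right nhdsWithin_le_nhds
  have hev : ∀ p : MvPolynomial (Fin n) ℝ,
      Tendsto (fun z : ℕ × (Fin n → ℝ) => eval z.2 p) (atTop ×ˢ nhdsWithin x s)
        (nhds (eval x p)) := fun p =>
    ((MvPolynomial.continuous_eval p).tendsto x).comp hsnd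
  have hmain : Tendsto (fun z : ℕ × (Fin n → ℝ) => eval z.2 (Qpoly n z.1 (a z.1) K))
      (atTop ×ˢ nhdsWithin x s) (nhds (eval x (Qlim n α K))) := by
    simp only [Qpoly, Qlim, map_sum]
    refine tendsto_finsetSum _ fun j _ => ?_
    simp only [map_mul, eval_C, map_pow, ← mul_assoc]
    refine Tendsto.mul ?_ (hev _)
    rw [← prod_limit]
    have hfac : ∀ l ∈ Finset.Icc 1 j, Tendsto (fun z : ℕ × (Fin n → ℝ) =>
        cSmall (z.1 - n) l * eval z.2 (C (a z.1 ^ 2) - ∑ i : Fin n, X i ^ 2))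
        (atTop ×ˢ nhdsWithin x s) (nhds (-1 / (2 * (l : ℝ)) * α ^ 2)) := by
      intro l hl
      have hl1 := (Finset.mem_Icc.mp hl).1
      have h1 := (cSmall_sq_tendsto n l hl1 α a hlim).comp
        (tendsto_fst (f := atTop) (g := nhdsWithin x s))
      have h2 := ((cSmall_tendsto_zero n l hl1).comp
        (tendsto_fst (f := atTop) (g := nhdsWithin x s))).mul (hev (∑ i : Fin n, X i ^ 2))
      have h3 := h1.sub h2
      rw [zero_mul, sub_zero] at h3
      refine h3.congr fun z => ?_
      simp only [Function.comp, map_sub, eval_C]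
      ring
    refine (tendsto_finsetProd _ hfac).congr fun z => ?_
    rw [Finset.prod_mul_distrib, Finset.prod_const, Nat.card_Icc, Nat.add_sub_cancel]
    simp [cBig]
  exact ((hev (Qlim n α K)).prodMk_nhds hmain).mono_right (nhds_le_uniformity _)
end

section
/- Fix n ∈ ℕ, α > 0 and a multi-index K ∈ ℕ₀^n, and let {a_N}_{N ≥ max(n,2)} be positive reals with a_N/√(N−1) → α as N → ∞. Then Q_{N,n,K;a_N} converges to Q_{n,K;α} strongly in L²(γ^n_α), i.e. ∫_{ℝ^n} |Q_{N,n,K;a_N}(x) − Q_{n,K;α}(x)|² dγ^n_α(x) → 0 as N → ∞. -/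
open MvPolynomial Filter Finset

open MeasureTheory

/-- The Gaussian measure `γ^n_α` on `ℝ^n` with variance `α²`. -/
noncomputable def gaussMeasure (n : ℕ) (α : ℝ) : Measure (Fin n → ℝ) :=
  volume.withDensity fun x =>
    ENNReal.ofReal ((2 * Real.pi * α ^ 2) ^ (-(n : ℝ) / 2) *
      Real.exp (-(∑ i, x i ^ 2) / (2 * α ^ 2)))

lemma aux_integrable_mono (n : ℕ) (b : ℝ) (hb : 0 < b) (k : Fin n → ℕ) :
    Integrable (fun x : Fin n → ℝ => ∏ i, (x i ^ k i * Real.exp (-b * x i ^ 2))) volume := by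
  refine Integrable.fintype_prod (f := fun i (t : ℝ) => t ^ k i * Real.exp (-b * t ^ 2)) ?_
  intro i
  have h := integrable_rpow_mul_exp_neg_mul_sq hb (s := (k i : ℝ))
    (lt_of_lt_of_le (by norm_num) (Nat.cast_nonneg (k i)))
  simpa only [Real.rpow_natCast] using h

lemma aux_integrable_poly (n : ℕ) (α : ℝ) (hα : 0 < α) (p : MvPolynomial (Fin n) ℝ) :
    Integrable (fun x => MvPolynomial.eval x p) (gaussMeasure n α) := by
  unfold gaussMeasure
  rw [integrable_withDensity_iff_integrable_smul' (by fun_prop) (by simp)]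
  have hb : 0 < 1 / (2 * α ^ 2) := by positivity
  have hc : 0 ≤ (2 * Real.pi * α ^ 2) ^ (-(n : ℝ) / 2) := by positivity
  induction p using MvPolynomial.monomial_add_induction_on with
  | C c =>
    have h := ((aux_integrable_mono n _ hb 0).const_mul
      ((2 * Real.pi * α ^ 2) ^ (-(n : ℝ) / 2))).mul_const c
    refine h.congr (Eventually.of_forall fun x => ?_)
    simp only [Pi.zero_apply, pow_zero, one_mul, eval_C, smul_eq_mul]
    rw [ENNReal.toReal_ofReal (by positivity), ← Real.exp_sum, ← Finset.mul_sum]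
    congr 3
    ring
  | monomial_add s c f _ _ h1 =>
    have h := ((aux_integrable_mono n _ hb s).const_mul
      ((2 * Real.pi * α ^ 2) ^ (-(n : ℝ) / 2))).mul_const c
    refine (h.add h1).congr (Eventually.of_forall fun x => ?_)
    simp only [Pi.add_apply, map_add, smul_add, eval_monomial, smul_eq_mul]
    congr 1
    rw [ENNReal.toReal_ofReal (by positivity), Finset.prod_mul_distrib, ← Real.exp_sum,
      ← Finset.mul_sum, Finsupp.prod_fintype _ _ (by simp)]
    rw [show -(1 / (2 * α ^ 2)) * ∑ i, x i ^ 2 = -(∑ i, x i ^ 2) / (2 * α ^ 2) by ring]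
    ring

lemma aux_tendsto_poly (n : ℕ) (α : ℝ) (hα : 0 < α) {ι : Type*} (S : Finset ι)
    (u : ℕ → ι → ℝ) (P : ι → MvPolynomial (Fin n) ℝ)
    (hu : ∀ s ∈ S, Tendsto (fun N => u N s) atTop (nhds 0)) :
    Tendsto (fun N : ℕ => ∫ x, (∑ s ∈ S, u N s * MvPolynomial.eval x (P s)) ^ 2
      ∂(gaussMeasure n α)) atTop (nhds 0) := by
  have key : ∀ N, ∫ x, (∑ s ∈ S, u N s * MvPolynomial.eval x (P s)) ^ 2 ∂(gaussMeasure n α)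
      = ∑ s ∈ S, ∑ t ∈ S, (u N s * u N t) *
        ∫ x, MvPolynomial.eval x (P s * P t) ∂(gaussMeasure n α) := by
    intro N
    have h : ∀ x : Fin n → ℝ, (∑ s ∈ S, u N s * MvPolynomial.eval x (P s)) ^ 2 =
        ∑ s ∈ S, ∑ t ∈ S, (u N s * u N t) * MvPolynomial.eval x (P s * P t) := by
      intro x
      rw [sq, Finset.sum_mul_sum]
      refine Finset.sum_congr rfl fun s _ => Finset.sum_congr rfl fun t _ => ?_
      rw [map_mul]; ring
    simp_rw [h]
    rw [integral_finsetSum]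
    · refine Finset.sum_congr rfl fun s _ => ?_
      rw [integral_finsetSum]
      · refine Finset.sum_congr rfl fun t _ => ?_
        rw [integral_const_mul]
      · intro t _
        exact (aux_integrable_poly n α hα _).const_mul _
    · intro s _
      refine integrable_finsetSum _ fun t _ => ?_
      exact (aux_integrable_poly n α hα _).const_mul _
  simp_rw [key]
  rw [show (0 : ℝ) = ∑ s ∈ S, ∑ t ∈ S, (0 * 0) *
        ∫ x, MvPolynomial.eval x (P s * P t) ∂(gaussMeasure n α) by simp]
  refine tendsto_finsetSum _ fun s hs => tendsto_finsetSum _ fun t ht => ?_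
  exact ((hu s hs).mul (hu t ht)).mul_const _

lemma aux_cSmall_zero (n l : ℕ) :
    Tendsto (fun N : ℕ => cSmall (N - n) l) atTop (nhds 0) := by
  unfold cSmall
  have h1 : Tendsto (fun N : ℕ => (((N - n : ℕ) : ℝ) + 2 * l - 1)) atTop atTop := by
    have := (tendsto_natCast_atTop_atTop (R := ℝ)).comp (tendsto_sub_atTop_nat n)
    refine (tendsto_atTop_add_const_right _ (2 * (l : ℝ) - 1) this).congr fun N => ?_
    simp [add_sub_assoc]
  have h2 := (h1.inv_tendsto_atTop).const_mul (-1 / (2 * (l : ℝ)))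
  rw [mul_zero] at h2
  refine h2.congr fun N => ?_
  simp only [Pi.inv_apply]
  rw [← div_eq_mul_inv, div_div]

lemma aux_cSmall_sq (n : ℕ) (α : ℝ) (a : ℕ → ℝ)
    (hlim : Tendsto (fun N : ℕ => a N / Real.sqrt ((N : ℝ) - 1)) atTop (nhds α)) (l : ℕ) :
    Tendsto (fun N : ℕ => cSmall (N - n) l * a N ^ 2) atTop (nhds (-α ^ 2 / (2 * l))) := by
  have h1 : Tendsto (fun N : ℕ => (((N - n : ℕ) : ℝ) + 2 * l - 1)) atTop atTop := by
    have := (tendsto_natCast_atTop_atTop (R := ℝ)).comp (tendsto_sub_atTop_nat n)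
    refine (tendsto_atTop_add_const_right _ (2 * (l : ℝ) - 1) this).congr fun N => ?_
    simp [add_sub_assoc]
  have h2 : Tendsto (fun N : ℕ => 1 + ((n : ℝ) - 2 * l) * (((N - n : ℕ) : ℝ) + 2 * l - 1)⁻¹)
      atTop (nhds 1) := by
    have := (h1.inv_tendsto_atTop.const_mul ((n : ℝ) - 2 * l)).const_add 1
    simpa using this
  have h3 := ((hlim.pow 2).mul h2).const_mul (-1 / (2 * (l : ℝ)))
  have e : -1 / (2 * (l : ℝ)) * (α ^ 2 * 1) = -α ^ 2 / (2 * l) := by ring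
  rw [e] at h3
  refine h3.congr' ?_
  filter_upwards [eventually_ge_atTop (n + 2), h1.eventually_gt_atTop 0] with N hN hpos
  unfold cSmall
  have hN' : (0 : ℝ) < (N : ℝ) - 1 := by
    have : ((n + 2 : ℕ) : ℝ) ≤ N := by exact_mod_cast hN
    push_cast at this
    have := Nat.cast_nonneg (α := ℝ) n
    linarith
  rw [div_pow, Real.sq_sqrt hN'.le]
  have hs : ((N - n : ℕ) : ℝ) = (N : ℝ) - n := by
    rw [Nat.cast_sub (by omega)]
  rw [hs] at hpos ⊢
  have hne := hpos.ne'
  have hne' := hN'.ne'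
  have e2 : 1 + ((n : ℝ) - 2 * l) * ((N : ℝ) - n + 2 * l - 1)⁻¹
      = (N - 1) / ((N : ℝ) - n + 2 * l - 1) := by
    field_simp
    ring
  rw [e2, ← div_div (-1)]
  field_simp

lemma aux_cBig_succ (m j : ℕ) : cBig m (j + 1) = cBig m j * cSmall m (j + 1) := by
  unfold cBig
  rw [Finset.prod_Icc_succ_top (by omega)]

lemma aux_cBig (n : ℕ) (α : ℝ) (a : ℕ → ℝ)
    (hlim : Tendsto (fun N : ℕ => a N / Real.sqrt ((N : ℝ) - 1)) atTop (nhds α)) (j : ℕ) :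
    ∀ k ≤ j, Tendsto (fun N : ℕ => cBig (N - n) j * (a N ^ 2) ^ k) atTop
      (nhds (if k = j then (-1 : ℝ) ^ j * α ^ (2 * j) / (2 ^ j * (Nat.factorial j)) else 0)) := by
  induction j with
  | zero =>
    intro k hk
    obtain rfl : k = 0 := by omega
    simp [cBig]
  | succ j ih =>
    intro k hk
    simp only [aux_cBig_succ]
    by_cases h : k = j + 1
    · subst h
      have := (ih j le_rfl).mul (aux_cSmall_sq n α a hlim (j + 1))
      rw [if_pos rfl] at this ⊢
      convert this using 1
      · funext N; ring
      · congr 1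
        rw [Nat.factorial_succ]
        push_cast
        field_simp
        ring
    · have := (ih k (by omega)).mul (aux_cSmall_zero n (j + 1))
      rw [if_neg h]
      rw [mul_zero] at this
      refine this.congr fun N => ?_
      ring

/-- if `a_N/√(N−1) → α`, the polynomials `Q_{N,n,K;a_N}` converge to `Q_{n,K;α}`
strongly in `L²(γ^n_α)`. -/
theorem Qpoly_tendsto_L2_gaussian
    (n : ℕ) (hn : 1 ≤ n) (α : ℝ) (hα : 0 < α) (K : Fin n → ℕ) (a : ℕ → ℝ)
    (ha : ∀ N, max n 2 ≤ N → 0 < a N)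
    (hlim : Tendsto (fun N : ℕ => a N / Real.sqrt ((N : ℝ) - 1)) atTop (nhds α)) :
    Tendsto (fun N : ℕ =>
        ∫ x, (MvPolynomial.eval x (Qpoly n N (a N) K)
          - MvPolynomial.eval x (Qlim n α K)) ^ 2 ∂(gaussMeasure n α))
      atTop (nhds 0) := by
  set v : ℕ → ℝ := fun j => (-1 : ℝ) ^ j * α ^ (2 * j) / (2 ^ j * (Nat.factorial j)) with hv
  set L : ℕ → MvPolynomial (Fin n) ℝ := fun j =>
    (lapOn (Finset.univ : Finset (Fin n)))^[j] (∏ i : Fin n, X i ^ K i) with hL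
  have main := aux_tendsto_poly n α hα
    ((Finset.range ((∑ i, K i) / 2 + 1)).sigma fun j => Finset.range (j + 1))
    (fun N s => cBig (N - n) s.1 * (a N ^ 2) ^ s.2 - if s.2 = s.1 then v s.1 else 0)
    (fun s => (-∑ i : Fin n, X i ^ 2) ^ (s.1 - s.2) * C ((s.1.choose s.2 : ℕ) : ℝ) * L s.1)
    (by
      rintro ⟨j, k⟩ hs
      simp only [Finset.mem_sigma, Finset.mem_range] at hs
      have := (aux_cBig n α a hlim j k (by omega)).sub_const (if k = j then v j else 0)
      simpa [hv] using this)
  refine main.congr fun N => ?_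
  congr 1
  funext x
  congr 1
  rw [Finset.sum_sigma, Qpoly, Qlim, map_sum, map_sum, ← Finset.sum_sub_distrib]
  refine Finset.sum_congr rfl fun j _ => ?_
  simp only [sub_mul, Finset.sum_sub_distrib]
  congr 1
  · rw [sub_eq_add_neg, add_pow]
    simp only [map_mul, map_sum, map_pow, map_neg, eval_C, eval_X, map_natCast,
      Finset.sum_mul, Finset.mul_sum]
    refine Finset.sum_congr rfl fun k _ => ?_
    simp only [hL]
    ring
  · rw [Finset.sum_eq_single j]
    · simp [hL, hv]
    · intro b _ hb
      simp [hb]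
    · simp
end

section
/- Fix n, N ∈ ℕ with n ≤ N and 2 ≤ N, k ∈ ℕ₀ and a > 0. Let P be a homogeneous polynomial on ℝ^{N+1} = ℝ^n × ℝ^{N−n+1} of degree k such that there exists a polynomial Q on ℝ^n with P(x,y) = Q(x) for all (x,y) ∈ S^N(a). Then there exist homogeneous polynomials Q_{k−2j} on ℝ^n of degree k−2j, for 0 ≤ j ≤ ⌊k/2⌋, such that P(x,y) = Σ_{j=0}^{⌊k/2⌋} |y|₂^{2j} Q_{k−2j}(x) for all (x,y) ∈ ℝ^n × ℝ^{N−n+1}. -/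
open MvPolynomial Filter Finset

theorem key_scale {N n k : ℕ} {a : ℝ} (ha : 0 < a)
    (P : MvPolynomial (Fin (N + 1)) ℝ) (hhom : P.IsHomogeneous k)
    (Q : MvPolynomial (Fin n) ℝ) (e : Fin n → Fin (N + 1))
    (hQ : ∀ z : Fin (N + 1) → ℝ, (∑ i, z i ^ 2) = a ^ 2 →
      MvPolynomial.eval z P = MvPolynomial.eval (fun i : Fin n => z (e i)) Q)
    (z w : Fin (N + 1) → ℝ) (hzw : ∀ i, z (e i) = w (e i))
    (hs : ∑ i, z i ^ 2 = ∑ i, w i ^ 2) : eval z P = eval w P := by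
  by_cases h0 : ∑ i, z i ^ 2 = 0
  · have hz : z = 0 := by
      funext i
      have := (Finset.sum_eq_zero_iff_of_nonneg (fun i _ => sq_nonneg (z i))).1 h0 i (mem_univ i)
      simpa using this
    have hw : w = 0 := by
      funext i
      have := (Finset.sum_eq_zero_iff_of_nonneg (fun i _ => sq_nonneg (w i))).1 (hs ▸ h0) i
        (mem_univ i)
      simpa using this
    rw [hz, hw]
  · have hpos : 0 < ∑ i, z i ^ 2 :=
      lt_of_le_of_ne (Finset.sum_nonneg fun i _ => sq_nonneg (z i)) (Ne.symm h0)
    set r := Real.sqrt (∑ i, z i ^ 2) with hr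
    have hrpos : 0 < r := Real.sqrt_pos.2 hpos
    have hr2 : r ^ 2 = ∑ i, z i ^ 2 := Real.sq_sqrt hpos.le
    have hc : a / r ≠ 0 := by positivity
    have sc : ∀ v : Fin (N + 1) → ℝ, eval (fun i => a / r * v i) P = (a / r) ^ k * eval v P := by
      intro v
      rw [eval_eq, eval_eq, Finset.mul_sum]
      refine Finset.sum_congr rfl fun d hd => ?_
      have hdk := hhom (mem_support_iff.1 hd)
      simp only [mul_pow, Finset.prod_mul_distrib, Finset.prod_pow_eq_pow_sum]
      have : ∑ i ∈ d.support, d i = k := by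
        rw [← hdk]; simp [Finsupp.weight_apply, Finsupp.sum]
      rw [this]; ring
    have h1 := hQ (fun i => a / r * z i) (by
      simp only [mul_pow, ← Finset.mul_sum]; rw [← hr2]; field_simp)
    have h2 := hQ (fun i => a / r * w i) (by
      simp only [mul_pow, ← Finset.mul_sum]; rw [← hs, ← hr2]; field_simp)
    rw [sc] at h1 h2
    simp only [hzw] at h1
    exact mul_left_cancel₀ (pow_ne_zero k hc) (h1.trans h2.symm)

theorem sum_even_only (c : ℕ → ℝ) (m : ℕ) (hc : ∀ j, c (2 * j + 1) = 0) :
    ∑ i ∈ range (2 * m), c i = ∑ j ∈ range m, c (2 * j) := by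
  induction m with
  | zero => simp
  | succ m ih =>
    rw [show 2 * (m + 1) = 2 * m + 1 + 1 by ring, sum_range_succ, sum_range_succ, ih, hc,
      sum_range_succ]; ring

theorem even_coeff (g : Polynomial ℝ) (h : ∀ t, g.eval (-t) = g.eval t) (j : ℕ) :
    g.coeff (2 * j + 1) = 0 := by
  have : g.comp (Polynomial.C (-1) * Polynomial.X) = g := by
    apply Polynomial.funext; intro t; simp [h]
  have h2 := congrArg (fun p => p.coeff (2 * j + 1)) this
  simp only [Polynomial.comp_C_mul_X_coeff] at h2
  have : (-1 : ℝ) ^ (2 * j + 1) = -1 := by simp [pow_succ, pow_mul]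
  rw [this] at h2; linarith

/-- a homogeneous polynomial `P` of degree `k` on `ℝ^{N+1} = ℝ^n × ℝ^{N−n+1}` that
factors through the projection onto the first `n` coordinates on the sphere `S^N(a)` decomposes
as `P(x,y) = Σ_{j=0}^{⌊k/2⌋} |y|₂^{2j} Q_{k−2j}(x)` with `Q_{k−2j}` homogeneous of degree `k−2j`. -/
theorem homogeneous_factoring_decomposition
    (n N k : ℕ) (hn : 1 ≤ n) (hnN : n ≤ N) (hN : 2 ≤ N) (a : ℝ) (ha : 0 < a)
    (P : MvPolynomial (Fin (N + 1)) ℝ) (hhom : P.IsHomogeneous k)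
    (Q : MvPolynomial (Fin n) ℝ)
    (hQ : ∀ z : Fin (N + 1) → ℝ, (∑ i, z i ^ 2) = a ^ 2 →
      MvPolynomial.eval z P
        = MvPolynomial.eval (fun i : Fin n => z (Fin.castLE (hnN.trans (Nat.le_succ N)) i)) Q) :
    ∃ Qs : ℕ → MvPolynomial (Fin n) ℝ,
      (∀ j, j ≤ k / 2 → (Qs j).IsHomogeneous (k - 2 * j)) ∧
      P = ∑ j ∈ Finset.range (k / 2 + 1),
        ySq n N ^ j * MvPolynomial.rename (Fin.castLE (hnN.trans (Nat.le_succ N))) (Qs j) := by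
  set e : Fin n → Fin (N + 1) := Fin.castLE (hnN.trans (Nat.le_succ N)) with he
  have key := key_scale ha P hhom Q e hQ
  let φ : Fin (N + 1) → MvPolynomial (Fin (n + 1)) ℝ := fun i =>
    if h : (i : ℕ) < n then X (Fin.succ ⟨i, h⟩) else if i = Fin.last N then X 0 else 0
  have hφ : ∀ i, (φ i).IsHomogeneous 1 := by
    intro i
    simp only [φ]
    split_ifs
    · exact isHomogeneous_X _ _
    · exact isHomogeneous_X _ _
    · exact isHomogeneous_zero _ _ _
  let p : MvPolynomial (Fin (n + 1)) ℝ := aeval φ P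
  have hp : p.IsHomogeneous k := by
    have := hhom.aeval (n := 1) φ hφ
    rwa [one_mul] at this
  let f := finSuccEquiv ℝ n p
  have hdeg : f.natDegree ≤ k := by
    rw [natDegree_finSuccEquiv]
    exact (degreeOf_le_totalDegree _ _).trans hp.totalDegree_le
  let v : (Fin n → ℝ) → ℝ → Fin (N + 1) → ℝ := fun x t i =>
    if h : (i : ℕ) < n then x ⟨i, h⟩ else if i = Fin.last N then t else 0
  have hev : ∀ x t, (f.map (eval x)).eval t = eval (v x t) P := by
    intro x t
    rw [← eval_eq_eval_mv_eval']
    change eval _ (aeval φ P) = _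
    rw [← MvPolynomial.coe_aeval_eq_eval, RingHom.coe_coe, ← AlgHom.comp_apply,
      MvPolynomial.comp_aeval, ← MvPolynomial.coe_aeval_eq_eval, RingHom.coe_coe]
    congr 2
    funext i
    simp only [φ, v]
    split_ifs
    · rw [aeval_X, Fin.cons_succ]
    · simp
    · simp
  have hve : ∀ x t i, v x t (e i) = x i := by
    intro x t i
    simp [v, he]
  have hvs : ∀ x t, ∑ i, v x t i ^ 2 =
      ∑ i ∈ univ.filter (fun i : Fin (N + 1) => (i : ℕ) < n), v x 0 i ^ 2 + t ^ 2 := by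
    intro x t
    rw [← Finset.sum_filter_add_sum_filter_not univ (fun i : Fin (N + 1) => (i : ℕ) < n)]
    congr 1
    · refine Finset.sum_congr rfl fun i hi => ?_
      have : (i : ℕ) < n := by simpa using hi
      simp [v, this]
    · rw [Finset.sum_eq_single (Fin.last N)]
      · simp [v, hnN]
      · intro i hi hne
        have : ¬ (i : ℕ) < n := by simpa using hi
        simp [v, this, hne]
      · intro h
        exact absurd (by simpa using hnN) h
  refine ⟨fun j => f.coeff (2 * j), fun j hj => ?_, ?_⟩
  · exact hp.finSuccEquiv_coeff_isHomogeneous _ _ (by omega)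
  · apply MvPolynomial.funext
    intro z
    set x : Fin n → ℝ := fun i => z (e i) with hx
    set y2 : ℝ := eval z (ySq n N) with hy2
    have hy2' : y2 = ∑ i ∈ univ.filter (fun i : Fin (N + 1) => ¬ (i : ℕ) < n), z i ^ 2 := by
      simp [hy2, ySq]
    have hy0 : 0 ≤ y2 := by
      rw [hy2']; exact Finset.sum_nonneg fun i _ => sq_nonneg _
    have h1 : eval z P = (f.map (eval x)).eval (Real.sqrt y2) := by
      rw [hev]
      apply key
      · intro i; rw [hve]
      · rw [hvs, Real.sq_sqrt hy0, hy2',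
          ← Finset.sum_filter_add_sum_filter_not univ (fun i : Fin (N + 1) => (i : ℕ) < n)]
        congr 1
        refine Finset.sum_congr rfl fun i hi => ?_
        have : (i : ℕ) < n := by simpa using hi
        simp [v, this, hx, he]
    have hodd := even_coeff (f.map (eval x)) (by
      intro t
      rw [hev, hev]
      apply key
      · intro i; rw [hve, hve]
      · rw [hvs, hvs]; ring)
    rw [h1, Polynomial.eval_eq_sum_range' (n := 2 * (k / 2 + 1))
      (lt_of_le_of_lt (Polynomial.natDegree_map_le.trans hdeg) (by omega)),
      sum_even_only (fun i => (f.map (eval x)).coeff i * Real.sqrt y2 ^ i) _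
        (fun j => by simp only [hodd, zero_mul])]
    rw [map_sum]
    refine Finset.sum_congr rfl fun j _ => ?_
    rw [map_mul, map_pow, eval_rename, ← hy2, pow_mul, Real.sq_sqrt hy0, Polynomial.coeff_map,
      mul_comm]
    rfl
end

section
/- Fix α > 0 and let {a_N}_{N ≥ 2} be positive reals with a_N/√(N−1) → α as N → ∞. Then: (i) ∫_{−a_N}^{a_N} (1 − ρ²/a_N²)^{N/2−1} dρ → √(2π) α as N → ∞; and (ii) for every fixed r ∈ ℝ, w_{N,a_N}(r) → w_∞(r) as N → ∞. -/
open Filter MeasureTheory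

/-- `s_{N,a}(r) = 1 − r²/a²` (independent of `N`). -/
noncomputable def sFun (a r : ℝ) : ℝ := 1 - r ^ 2 / a ^ 2

/-- The normalized weight `w_{N,a}(r) = s_{N,a}(r)^{N/2−1} / ∫_{−a}^{a} s_{N,a}(ρ)^{N/2−1} dρ`
for `r ∈ (−a,a)`, and `0` for `|r| ≥ a`. -/
noncomputable def wFun (N : ℕ) (a r : ℝ) : ℝ :=
  if |r| < a then
    sFun a r ^ ((N : ℝ) / 2 - 1) / ∫ ρ in Set.Ioo (-a) a, sFun a ρ ^ ((N : ℝ) / 2 - 1)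
  else 0

/-- The Gaussian weight `w_∞(r) = (2π)^{−1/2} α^{−1} e^{−r²/(2α²)}`. -/
noncomputable def wInf (α r : ℝ) : ℝ :=
  (Real.sqrt (2 * Real.pi) * α)⁻¹ * Real.exp (-r ^ 2 / (2 * α ^ 2))

lemma aux_limits (α : ℝ) (hα : 0 < α) (a : ℕ → ℝ)
    (hlim : Tendsto (fun N : ℕ => a N / Real.sqrt ((N : ℝ) - 1)) atTop (nhds α)) :
    Tendsto a atTop atTop ∧
    Tendsto (fun N : ℕ => ((N : ℝ) / 2 - 1) / a N ^ 2) atTop (nhds (1 / (2 * α ^ 2))) := by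
  have hN : Tendsto (fun N : ℕ => (N : ℝ) - 1) atTop atTop :=
    tendsto_atTop_add_const_right _ (-1) tendsto_natCast_atTop_atTop
  have hs : Tendsto (fun N : ℕ => Real.sqrt ((N : ℝ) - 1)) atTop atTop :=
    Real.tendsto_sqrt_atTop.comp hN
  constructor
  · refine (hlim.pos_mul_atTop hα hs).congr' ?_
    filter_upwards [hs.eventually_gt_atTop 0] with N h
    field_simp
  · have h1 : Tendsto (fun N : ℕ => (1 / 2 - 1 / 2 * ((N : ℝ) - 1)⁻¹) *
        ((a N / Real.sqrt ((N : ℝ) - 1)) ^ 2)⁻¹) atTop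
        (nhds ((1 / 2 - 1 / 2 * 0) * (α ^ 2)⁻¹)) :=
      (tendsto_const_nhds.sub (hN.inv_tendsto_atTop.const_mul _)).mul
        ((hlim.pow 2).inv₀ (by positivity))
    have h2 : (1 / 2 - 1 / 2 * 0) * (α ^ 2)⁻¹ = 1 / (2 * α ^ 2) := by
      field_simp
      try ring
    rw [h2] at h1
    refine h1.congr' ?_
    filter_upwards [hN.eventually_gt_atTop 0] with N h
    rw [div_pow, Real.sq_sqrt h.le, inv_div]
    by_cases h0 : a N = 0
    · simp [h0]
    · have := h.ne'
      field_simp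
      ring

lemma aux_pointwise (α : ℝ) (hα : 0 < α) (a : ℕ → ℝ)
    (hlim : Tendsto (fun N : ℕ => a N / Real.sqrt ((N : ℝ) - 1)) atTop (nhds α)) (r : ℝ) :
    Tendsto (fun N : ℕ => (1 - r ^ 2 / a N ^ 2) ^ ((N : ℝ) / 2 - 1)) atTop
      (nhds (Real.exp (-r ^ 2 / (2 * α ^ 2)))) := by
  obtain ⟨hA, hK⟩ := aux_limits α hα a hlim
  have ht : Tendsto (fun N : ℕ => 1 - r ^ 2 / a N ^ 2) atTop (nhds 1) := by
    have h := ((tendsto_pow_atTop (two_ne_zero)).comp hA).const_div_atTop (r ^ 2)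
    simpa using (tendsto_const_nhds (x := (1 : ℝ))).sub h
  have hup : Tendsto (fun N : ℕ => -r ^ 2 * (((N : ℝ) / 2 - 1) / a N ^ 2)) atTop
      (nhds (-r ^ 2 / (2 * α ^ 2))) := by
    have := hK.const_mul (-r ^ 2)
    rwa [mul_one_div] at this
  have hlo := hup.mul (ht.inv₀ one_ne_zero)
  rw [inv_one, mul_one] at hlo
  have hlog : Tendsto (fun N : ℕ => Real.log (1 - r ^ 2 / a N ^ 2) * ((N : ℝ) / 2 - 1)) atTop
      (nhds (-r ^ 2 / (2 * α ^ 2))) := by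
    refine tendsto_of_tendsto_of_tendsto_of_le_of_le' hlo hup ?_ ?_
    · filter_upwards [ht.eventually_const_lt one_pos, eventually_ge_atTop 2] with N h h2
      have hp : 0 ≤ (N : ℝ) / 2 - 1 := by
        have : (2 : ℝ) ≤ N := by exact_mod_cast h2
        linarith
      have h3 := mul_le_mul_of_nonneg_right (Real.one_sub_inv_le_log_of_pos h) hp
      refine le_trans (le_of_eq ?_) h3
      have h4 : 1 - (1 - r ^ 2 / a N ^ 2)⁻¹ = -(r ^ 2 / a N ^ 2) * (1 - r ^ 2 / a N ^ 2)⁻¹ := by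
        have := h.ne'
        generalize r ^ 2 / a N ^ 2 = t at *
        field_simp
        ring
      rw [h4]
      ring
    · filter_upwards [ht.eventually_const_lt one_pos, eventually_ge_atTop 2] with N h h2
      have hp : 0 ≤ (N : ℝ) / 2 - 1 := by
        have : (2 : ℝ) ≤ N := by exact_mod_cast h2
        linarith
      have h3 := mul_le_mul_of_nonneg_right (Real.log_le_sub_one_of_pos h) hp
      refine le_trans h3 (le_of_eq ?_)
      ring
  refine ((Real.continuous_exp.tendsto _).comp hlog).congr' ?_
  filter_upwards [ht.eventually_const_lt one_pos] with N h
  simp only [Function.comp]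
  rw [Real.rpow_def_of_pos h]

lemma aux_integral (α : ℝ) (hα : 0 < α) (a : ℕ → ℝ)
    (hlim : Tendsto (fun N : ℕ => a N / Real.sqrt ((N : ℝ) - 1)) atTop (nhds α)) :
    Tendsto (fun N : ℕ => ∫ ρ in Set.Ioo (-(a N)) (a N), (1 - ρ ^ 2 / a N ^ 2) ^ ((N : ℝ) / 2 - 1))
        atTop (nhds (Real.sqrt (2 * Real.pi) * α)) := by
  obtain ⟨hA, hK⟩ := aux_limits α hα a hlim
  have hval : Real.sqrt (2 * Real.pi) * α = ∫ r : ℝ, Real.exp (-r ^ 2 / (2 * α ^ 2)) := by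
    have h := integral_gaussian (1 / (2 * α ^ 2))
    have h1 : Real.pi / (1 / (2 * α ^ 2)) = 2 * Real.pi * α ^ 2 := by
      field_simp
    rw [h1, Real.sqrt_mul (by positivity), Real.sqrt_sq hα.le] at h
    rw [← h]
    congr 1
    ext r
    congr 1
    ring
  rw [hval]
  have hset : ∀ N : ℕ, (∫ ρ in Set.Ioo (-(a N)) (a N), (1 - ρ ^ 2 / a N ^ 2) ^ ((N : ℝ) / 2 - 1))
      = ∫ ρ, (Set.Ioo (-(a N)) (a N)).indicator
        (fun ρ => (1 - ρ ^ 2 / a N ^ 2) ^ ((N : ℝ) / 2 - 1)) ρ := fun N =>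
    (integral_indicator measurableSet_Ioo).symm
  simp_rw [hset]
  have hc : 1 / (4 * α ^ 2) < 1 / (2 * α ^ 2) := by
    apply one_div_lt_one_div_of_lt <;> nlinarith [sq_pos_of_pos hα]
  refine tendsto_integral_filter_of_dominated_convergence
    (fun r => Real.exp (-(1 / (4 * α ^ 2)) * r ^ 2)) ?_ ?_
    (integrable_exp_neg_mul_sq (by positivity)) ?_
  · refine Eventually.of_forall fun N => ?_
    apply Measurable.aestronglyMeasurable
    apply Measurable.indicator _ measurableSet_Ioo
    fun_prop
  · filter_upwards [hA.eventually_gt_atTop 0, hK.eventually_const_lt hc,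
      eventually_ge_atTop 2] with N h0 hk h2
    refine Eventually.of_forall fun r => ?_
    have hp : 0 ≤ (N : ℝ) / 2 - 1 := by
      have : (2 : ℝ) ≤ N := by exact_mod_cast h2
      linarith
    by_cases hr : r ∈ Set.Ioo (-(a N)) (a N)
    · rw [Set.indicator_of_mem hr]
      have hlt : r ^ 2 / a N ^ 2 < 1 := by
        rw [div_lt_one (by positivity)]
        exact sq_lt_sq' hr.1 hr.2
      have h : 0 < 1 - r ^ 2 / a N ^ 2 := by linarith
      rw [Real.norm_of_nonneg (Real.rpow_nonneg h.le _), Real.rpow_def_of_pos h]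
      apply Real.exp_le_exp.mpr
      have h3 := mul_le_mul_of_nonneg_right (Real.log_le_sub_one_of_pos h) hp
      refine h3.trans ?_
      have h4 := mul_le_mul_of_nonneg_right hk.le (sq_nonneg r)
      have h5 : (1 - r ^ 2 / a N ^ 2 - 1) * ((N : ℝ) / 2 - 1)
        = -(((N : ℝ) / 2 - 1) / a N ^ 2 * r ^ 2) := by ring
      rw [h5, neg_mul]
      exact neg_le_neg h4
    · rw [Set.indicator_of_notMem hr, norm_zero]
      positivity
  · refine Eventually.of_forall fun r => ?_
    refine (aux_pointwise α hα a hlim r).congr' ?_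
    filter_upwards [hA.eventually_gt_atTop |r|] with N h
    rw [Set.indicator_of_mem (Set.mem_Ioo.mpr (abs_lt.mp h))]

/-- if `a_N/√(N−1) → α`, then (i) the normalizing integrals
`∫_{−a_N}^{a_N} (1−ρ²/a_N²)^{N/2−1} dρ` converge to `√(2π) α`, and (ii) `w_{N,a_N}(r) → w_∞(r)`
for every fixed `r`. -/
theorem normalizing_integral_and_weight_tendsto
    (α : ℝ) (hα : 0 < α) (a : ℕ → ℝ) (ha : ∀ N, 2 ≤ N → 0 < a N)
    (hlim : Tendsto (fun N : ℕ => a N / Real.sqrt ((N : ℝ) - 1)) atTop (nhds α)) :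
    Tendsto (fun N : ℕ => ∫ ρ in Set.Ioo (-(a N)) (a N), (1 - ρ ^ 2 / a N ^ 2) ^ ((N : ℝ) / 2 - 1))
        atTop (nhds (Real.sqrt (2 * Real.pi) * α)) ∧
    ∀ r : ℝ, Tendsto (fun N : ℕ => wFun N (a N) r) atTop (nhds (wInf α r)) := by
  have hI := aux_integral α hα a hlim
  refine ⟨hI, fun r => ?_⟩
  have hne : Real.sqrt (2 * Real.pi) * α ≠ 0 := by positivity
  have h := (aux_pointwise α hα a hlim r).div hI hne
  have hw : wInf α r = Real.exp (-r ^ 2 / (2 * α ^ 2)) / (Real.sqrt (2 * Real.pi) * α) := by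
    exact (div_eq_inv_mul _ _).symm
  rw [hw]
  refine h.congr' ?_
  filter_upwards [(aux_limits α hα a hlim).1.eventually_gt_atTop |r|] with N hN
  simp [wFun, hN, sFun]
end

section
/- Fix α > 0 and let {a_N}_{N ≥ 2} be positive reals with a_N/√(N−1) → α as N → ∞. For each N set ϖ_N := sup_{r ∈ (−a_N, a_N)} w_{N,a_N}(r)/w_∞(r) and A_N := (a_N² − α²(N−2))/a_N. Then the sequence {ϖ_N}_N is bounded if and only if the sequence {A_N}_N is bounded from above. -/
open Filter MeasureTheory

lemma aux_log_upper {t : ℝ} (h0 : 0 ≤ t) (h1 : t < 1) : Real.log (1 - t) ≤ -t - t ^ 2 / 2 := by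
  have h := Real.hasSum_pow_div_log_of_abs_lt_one (x := t) (by rw [abs_of_nonneg h0]; exact h1)
  have h2 := sum_le_hasSum (Finset.range 2) (fun i _ => by positivity) h
  simp [Finset.sum_range_succ] at h2
  norm_num at h2
  linarith

lemma aux_log_lower {t : ℝ} (h0 : 0 ≤ t) (h1 : t ≤ 1 / 2) : -t - 2 * t ^ 2 ≤ Real.log (1 - t) := by
  have h := Real.one_sub_inv_le_log_of_pos (x := 1 - t) (by linarith)
  have h2 : (1 - t)⁻¹ ≤ 1 + t + 2 * t ^ 2 := by
    rw [inv_le_iff_one_le_mul₀ (by linarith)]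
    nlinarith [mul_nonneg (sq_nonneg t) (by linarith : 0 ≤ 1 / 2 - t)]
  linarith

lemma aux_s {a r : ℝ} (hr : r ∈ Set.Ioo (-a) a) : 0 ≤ r ^ 2 / a ^ 2 ∧ r ^ 2 / a ^ 2 < 1 := by
  obtain ⟨h1, h2⟩ := hr
  have : 0 < a := by linarith
  refine ⟨by positivity, ?_⟩
  rw [div_lt_one (by positivity)]
  nlinarith

lemma aux_rpow {a r p : ℝ} (hr : r ∈ Set.Ioo (-a) a) :
    sFun a r ^ p = Real.exp (p * Real.log (1 - r ^ 2 / a ^ 2)) := by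
  have := (aux_s hr).2
  rw [sFun, Real.rpow_def_of_pos (by linarith), mul_comm]

lemma aux_bound {a r n : ℝ} (hn : 1 ≤ n) (hr : r ∈ Set.Ioo (-a) a) :
    sFun a r ^ ((n - 1) / 2) ≤ Real.exp 1 * Real.exp (-(n / (2 * a ^ 2)) * r ^ 2) := by
  rw [aux_rpow hr, ← Real.exp_add, Real.exp_le_exp]
  have h := aux_s hr
  have h1 := aux_log_upper h.1 h.2
  have e : -(n / (2 * a ^ 2)) * r ^ 2 = - (n / 2) * (r ^ 2 / a ^ 2) := by ring
  rw [e]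
  set t := r ^ 2 / a ^ 2
  nlinarith [mul_le_mul_of_nonneg_left h1 (by linarith : 0 ≤ (n - 1) / 2),
    mul_nonneg (by linarith : 0 ≤ n - 1) (sq_nonneg t)]

lemma aux_int {a n : ℝ} (ha : 0 < a) (hn : 1 ≤ n) :
    IntegrableOn (fun ρ => sFun a ρ ^ ((n - 1) / 2)) (Set.Ioo (-a) a) := by
  have hc : Continuous (fun ρ => sFun a ρ ^ ((n - 1) / 2)) := by
    unfold sFun
    refine Continuous.rpow_const (by fun_prop) ?_
    intro x; right; linarith
  exact (hc.integrableOn_Icc (a := -a) (b := a)).mono_set Set.Ioo_subset_Icc_self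

lemma aux_I_upper {a n : ℝ} (ha : 0 < a) (hn : 1 ≤ n) :
    ∫ ρ in Set.Ioo (-a) a, sFun a ρ ^ ((n - 1) / 2)
      ≤ Real.exp 1 * Real.sqrt (2 * Real.pi) * (a / Real.sqrt n) := by
  have hb : 0 < n / (2 * a ^ 2) := by positivity
  have hg := (integrable_exp_neg_mul_sq hb).const_mul (Real.exp 1)
  calc _ ≤ ∫ ρ in Set.Ioo (-a) a, Real.exp 1 * Real.exp (-(n / (2 * a ^ 2)) * ρ ^ 2) :=
        setIntegral_mono_on (aux_int ha hn) hg.integrableOn measurableSet_Ioo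
          (fun r hr => aux_bound hn hr)
    _ ≤ ∫ ρ, Real.exp 1 * Real.exp (-(n / (2 * a ^ 2)) * ρ ^ 2) :=
        setIntegral_le_integral hg (Eventually.of_forall fun x => by positivity)
    _ = _ := by
        rw [integral_const_mul, integral_gaussian, mul_assoc]
        congr 1
        have : Real.pi / (n / (2 * a ^ 2)) = (2 * Real.pi) * (a ^ 2 / n) := by
          field_simp
        rw [this, Real.sqrt_mul (by positivity), Real.sqrt_div (by positivity), Real.sqrt_sq ha.le]

lemma aux_I_lower {a n : ℝ} (ha : 0 < a) (hn : 1 ≤ n) :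
    Real.exp (-1) * (a / Real.sqrt n) ≤
      ∫ ρ in Set.Ioo (-a) a, sFun a ρ ^ ((n - 1) / 2) := by
  have hs : 1 ≤ Real.sqrt n := by rw [Real.one_le_sqrt]; exact hn
  have hsq : Real.sqrt n ^ 2 = n := Real.sq_sqrt (by linarith)
  set s := Real.sqrt n
  set d := a / s / 2 with hd
  have hd0 : 0 < d := by positivity
  have hda : d < a := by
    have : a / s ≤ a := div_le_self ha.le hs
    linarith
  have hsub : Set.Ioo (-d) d ⊆ Set.Ioo (-a) a := Set.Ioo_subset_Ioo (by linarith) hda.le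
  calc _ = ∫ ρ in Set.Ioo (-d) d, Real.exp (-1) := by
        rw [setIntegral_const]
        simp only [Measure.real, Real.volume_Ioo, smul_eq_mul]
        rw [ENNReal.toReal_ofReal (by linarith), hd]; ring
    _ ≤ ∫ ρ in Set.Ioo (-d) d, sFun a ρ ^ ((n - 1) / 2) := by
        refine setIntegral_mono_on (by simp) ((aux_int ha hn).mono_set hsub)
          measurableSet_Ioo ?_
        intro r hr
        rw [aux_rpow (hsub hr), Real.exp_le_exp]
        have h := aux_s (hsub hr)
        have hr2 : r ^ 2 ≤ d ^ 2 := by nlinarith [hr.1, hr.2]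
        have ht : n * (r ^ 2 / a ^ 2) ≤ 1 / 4 := by
          have : d ^ 2 = a ^ 2 / n / 4 := by rw [hd, div_pow, div_pow, hsq]; norm_num
          rw [this] at hr2
          rw [← mul_div_assoc, div_le_iff₀ (by positivity)]
          have := mul_le_mul_of_nonneg_left hr2 (by linarith : 0 ≤ n)
          have e : n * (a ^ 2 / n / 4) = 1 / 4 * a ^ 2 := by field_simp
          linarith
        set t := r ^ 2 / a ^ 2
        have ht1 : t ≤ 1 / 4 := by nlinarith [h.1]
        have h1 := aux_log_lower h.1 (by linarith)
        have h2 : - (2 * t) ≤ Real.log (1 - t) := by nlinarith [h.1]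
        nlinarith [mul_le_mul_of_nonneg_left h2 (by linarith : 0 ≤ (n - 1) / 2), h.1]
    _ ≤ _ := by
        refine setIntegral_mono_set (aux_int ha hn) ?_ hsub.eventuallyLE
        filter_upwards [ae_restrict_mem measurableSet_Ioo] with r hr
        have := aux_rpow (p := (n - 1) / 2) hr
        simp only [Pi.zero_apply]
        rw [this]; positivity

lemma aux_ratio {N : ℕ} {a r α : ℝ} (hα : 0 < α) (hr : r ∈ Set.Ioo (-a) a) :
    wFun N a r / wInf α r = Real.sqrt (2 * Real.pi) * α *
      Real.exp ((((N : ℝ) - 1 - 1) * Real.log (1 - r ^ 2 / a ^ 2) +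
        a ^ 2 / α ^ 2 * (r ^ 2 / a ^ 2)) / 2) /
      ∫ ρ in Set.Ioo (-a) a, sFun a ρ ^ (((N : ℝ) - 1 - 1) / 2) := by
  have hN : (N : ℝ) / 2 - 1 = ((N : ℝ) - 1 - 1) / 2 := by ring
  have ha : 0 < a := by linarith [hr.1, hr.2]
  rw [wFun, if_pos (abs_lt.2 hr), wInf, hN, aux_rpow hr]
  have e : ((((N : ℝ) - 1 - 1) * Real.log (1 - r ^ 2 / a ^ 2) +
        a ^ 2 / α ^ 2 * (r ^ 2 / a ^ 2)) / 2) =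
      (((N : ℝ) - 1 - 1) / 2 * Real.log (1 - r ^ 2 / a ^ 2)) - (-r ^ 2 / (2 * α ^ 2)) := by
    have : a ^ 2 / α ^ 2 * (r ^ 2 / a ^ 2) = r ^ 2 / α ^ 2 := by field_simp
    rw [this]; ring
  rw [e, Real.exp_sub]
  generalize (∫ ρ in Set.Ioo (-a) a, sFun a ρ ^ (((N : ℝ) - 1 - 1) / 2)) = I
  have := Real.exp_pos (-r ^ 2 / (2 * α ^ 2))
  have : 0 < Real.sqrt (2 * Real.pi) := by positivity
  simp only [div_eq_mul_inv, mul_inv, inv_inv]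
  ring

/-- if `a_N/√(N−1) → α`, the family `ϖ_N = sup_{r∈(−a_N,a_N)} w_{N,a_N}(r)/w_∞(r)`
is bounded if and only if `A_N = (a_N² − α²(N−2))/a_N` is bounded from above. -/
theorem sup_weight_ratio_bounded_iff
    (α : ℝ) (hα : 0 < α) (a : ℕ → ℝ) (ha : ∀ N, 2 ≤ N → 0 < a N)
    (hlim : Tendsto (fun N : ℕ => a N / Real.sqrt ((N : ℝ) - 1)) atTop (nhds α)) :
    (∃ C : ℝ, ∀ N, 2 ≤ N → ∀ r ∈ Set.Ioo (-(a N)) (a N), wFun N (a N) r / wInf α r ≤ C) ↔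
    (∃ C : ℝ, ∀ N, 2 ≤ N → (a N ^ 2 - α ^ 2 * ((N : ℝ) - 2)) / a N ≤ C) := by
  obtain ⟨M1, hM1⟩ := hlim.bddAbove_range
  obtain ⟨M2, hM2⟩ := (hlim.inv₀ hα.ne').bddAbove_range
  have hM1 : ∀ N : ℕ, a N / Real.sqrt ((N : ℝ) - 1) ≤ M1 := fun N => hM1 ⟨N, rfl⟩
  have hM2 : ∀ N : ℕ, (a N / Real.sqrt ((N : ℝ) - 1))⁻¹ ≤ M2 := fun N => hM2 ⟨N, rfl⟩
  have hn : ∀ N : ℕ, 2 ≤ N → (1 : ℝ) ≤ (N : ℝ) - 1 := fun N h => by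
    have : (2 : ℝ) ≤ N := by exact_mod_cast h
    linarith
  have hs : ∀ N : ℕ, 2 ≤ N → 1 ≤ Real.sqrt ((N : ℝ) - 1) := fun N h => by
    rw [Real.one_le_sqrt]; exact hn N h
  have hq : ∀ N : ℕ, 2 ≤ N → 0 < a N / Real.sqrt ((N : ℝ) - 1) := fun N h =>
    div_pos (ha N h) (by linarith [hs N h])
  have hM1p : 0 < M1 := (hq 2 le_rfl).trans_le (hM1 2)
  have hM2p : 0 < M2 := (inv_pos.2 (hq 2 le_rfl)).trans_le (hM2 2)
  have hw : 0 < Real.sqrt (2 * Real.pi) := by positivity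
  constructor
  · rintro ⟨C, hC⟩
    set B := Real.exp 1 * Real.sqrt (2 * Real.pi) * M1 with hB
    have hBp : 0 < B := by positivity
    set K := Real.sqrt (2 * Real.pi) * α with hK
    have hKp : 0 < K := by positivity
    -- bound on the exponent
    set E := |C| * B / K with hE
    have hEp : 0 ≤ E := by positivity
    refine ⟨α ^ 2 * ((4 * E + 1) * M2), fun N h => ?_⟩
    have haN := ha N h
    have hsN := hs N h
    have hnN := hn N h
    have hsq : Real.sqrt ((N : ℝ) - 1) ^ 2 = (N : ℝ) - 1 := Real.sq_sqrt (by linarith)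
    have h2 := hM2 N
    have hIu := (aux_I_upper haN hnN).trans
      (mul_le_mul_of_nonneg_left (hM1 N) (by positivity))
    have hIl := (by have := hq N h; positivity :
      0 < Real.exp (-1) * (a N / Real.sqrt ((N : ℝ) - 1))).trans_le (aux_I_lower haN hnN)
    rw [inv_div] at h2
    set s := Real.sqrt ((N : ℝ) - 1) with hs'
    set t := 1 / (2 * s) with ht
    have ht0 : 0 < t := by positivity
    have ht1 : t ≤ 1 / 2 := by
      rw [ht]; exact one_div_le_one_div_of_le (by norm_num) (by linarith)
    have hst : Real.sqrt t < 1 := by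
      rw [Real.sqrt_lt' one_pos]; linarith
    have hr : a N * Real.sqrt t ∈ Set.Ioo (-(a N)) (a N) := by
      constructor
      · have : 0 ≤ a N * Real.sqrt t := by positivity
        linarith
      · nlinarith
    have hrt : (a N * Real.sqrt t) ^ 2 / a N ^ 2 = t := by
      rw [mul_pow, Real.sq_sqrt ht0.le]; field_simp
    have hCr := hC N h _ hr
    rw [aux_ratio hα hr, hrt, div_le_iff₀ hIl] at hCr
    set I := ∫ ρ in Set.Ioo (-(a N)) (a N), sFun (a N) ρ ^ (((N : ℝ) - 1 - 1) / 2)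
    set x := ((N : ℝ) - 1 - 1) * Real.log (1 - t) + a N ^ 2 / α ^ 2 * t with hx
    have hCI : C * I ≤ |C| * B :=
      mul_le_mul (le_abs_self C) hIu hIl.le (abs_nonneg C)
    have hxE : x / 2 ≤ E := by
      have h3 : Real.exp (x / 2) ≤ E := by
        rw [hE, le_div_iff₀ hKp]; linarith
      linarith [Real.add_one_le_exp (x / 2)]
    have hl := aux_log_lower ht0.le ht1
    have hl2 := mul_le_mul_of_nonneg_left hl (by linarith : 0 ≤ (N : ℝ) - 1 - 1)
    have hnt : ((N : ℝ) - 1) * t ^ 2 = 1 / 4 := by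
      rw [← hsq, ht]; field_simp; norm_num
    set D := a N ^ 2 / α ^ 2 - ((N : ℝ) - 1 - 1) with hD
    have hDt : D * t ≤ 2 * E + 1 / 2 := by
      rw [hD]; nlinarith [sq_nonneg t]
    have hDs : D ≤ (4 * E + 1) * s := by
      rw [ht, mul_one_div, div_le_iff₀ (by positivity)] at hDt
      linarith
    rw [div_le_iff₀ haN] at h2 ⊢
    have e : a N ^ 2 - α ^ 2 * ((N : ℝ) - 2) = α ^ 2 * D := by
      rw [hD]; field_simp; ring
    rw [e]
    have : (4 * E + 1) * s ≤ (4 * E + 1) * (M2 * a N) :=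
      mul_le_mul_of_nonneg_left h2 (by linarith)
    have := mul_le_mul_of_nonneg_left (hDs.trans this) (sq_nonneg α)
    linarith
  · rintro ⟨C, hC⟩
    set G := |C| / α ^ 2 * M1 with hG
    have hGp : 0 ≤ G := by positivity
    refine ⟨Real.sqrt (2 * Real.pi) * α * Real.exp ((1 + G ^ 2) / 2) * (Real.exp 1 * M2),
      fun N h r hr => ?_⟩
    have haN := ha N h
    have hsN := hs N h
    have hnN := hn N h
    have hsq : Real.sqrt ((N : ℝ) - 1) ^ 2 = (N : ℝ) - 1 := Real.sq_sqrt (by linarith)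
    have h1 := hM1 N
    have h2 := hM2 N
    have hqN := hq N h
    have hIl := aux_I_lower haN hnN
    have hI0 : 0 < Real.exp (-1) * (a N / Real.sqrt ((N : ℝ) - 1)) := by positivity
    have hIi := (inv_anti₀ hI0 hIl).trans (by
      rw [mul_inv, Real.exp_neg, inv_inv]
      exact mul_le_mul_of_nonneg_left h2 (by positivity) :
      _ ≤ Real.exp 1 * M2)
    have hCN := hC N h
    rw [aux_ratio hα hr, div_eq_mul_inv]
    refine mul_le_mul ?_ hIi (inv_nonneg.2 (hI0.le.trans hIl)) (by positivity)
    refine mul_le_mul_of_nonneg_left ?_ (by positivity)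
    rw [Real.exp_le_exp]
    obtain ⟨ht0, ht1⟩ := aux_s hr
    set s := Real.sqrt ((N : ℝ) - 1) with hs'
    set t := r ^ 2 / a N ^ 2 with ht
    have hl := aux_log_upper ht0 ht1
    have hl2 := mul_le_mul_of_nonneg_left hl (by linarith : 0 ≤ (N : ℝ) - 1 - 1)
    rw [div_le_iff₀ (by linarith)] at h1
    rw [div_le_iff₀ haN] at hCN
    set D := a N ^ 2 / α ^ 2 - ((N : ℝ) - 1 - 1) with hD
    have hDs : D ≤ G * s := by
      have e : a N ^ 2 - α ^ 2 * ((N : ℝ) - 2) = α ^ 2 * D := by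
        rw [hD]; field_simp; ring
      rw [e] at hCN
      have h3 : C * a N ≤ |C| * (M1 * s) :=
        mul_le_mul (le_abs_self C) h1 haN.le (abs_nonneg C)
      have h4 : D ≤ |C| * (M1 * s) / α ^ 2 := by
        rw [le_div_iff₀ (by positivity)]; linarith
      refine h4.trans (le_of_eq ?_)
      rw [hG]; ring
    have hDt := mul_le_mul_of_nonneg_right hDs ht0
    have hst : s ^ 2 * t ^ 2 = ((N : ℝ) - 1) * t ^ 2 := by rw [hsq]
    have ht2 : t ^ 2 ≤ 1 := by nlinarith
    have hDe : a N ^ 2 / α ^ 2 * t = D * t + ((N : ℝ) - 1 - 1) * t := by rw [hD]; ring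
    rw [hDe]
    nlinarith [sq_nonneg (G - s * t)]
end

section
/- Fix α > 0 and R ∈ ℝ. Let {a_N}_{N ≥ 2} be positive reals and {θ_N}_{N ≥ 2} ⊂ (0,π) with a_N/√(N−1) → α and a_N cos θ_N → αR as N → ∞. Then ∫_{a_N cos θ_N}^{a_N} w_{N,a_N}(r) dr (which equals the ratio ∫_0^{θ_N} sin^{N−1}θ dθ / ∫_0^{π} sin^{N−1}θ dθ of spherical cap volume to total sphere volume) converges as N → ∞ to γ¹_α((αR, ∞)) = ∫_{αR}^{∞} w_∞(r) dr, and this limit lies in the open interval (0,1). -/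
open Filter MeasureTheory

open Real in
lemma cap_subst (N : ℕ) (hN : 2 ≤ N) (a θ : ℝ) (ha : 0 < a) (h0 : 0 < θ) (h1 : θ ≤ π) :
    ∫ r in Set.Ioo (a * cos θ) a, sFun a r ^ ((N : ℝ) / 2 - 1)
      = a * ∫ t in Set.Ioo 0 θ, sin t ^ (N - 1) := by
  have himg : (fun t => a * cos t) '' Set.Ioo 0 θ = Set.Ioo (a * cos θ) a := by
    ext r
    constructor
    · rintro ⟨t, ⟨ht0, ht1⟩, rfl⟩
      constructor
      · exact mul_lt_mul_of_pos_left (cos_lt_cos_of_nonneg_of_le_pi ht0.le h1 ht1) ha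
      · have := cos_lt_cos_of_nonneg_of_le_pi le_rfl (ht1.le.trans h1) ht0
        rw [cos_zero] at this
        change a * cos t < a
        nlinarith
    · rintro ⟨hr0, hr1⟩
      have e1 : r / a < 1 := (div_lt_one ha).2 hr1
      have e2 : cos θ < r / a := by rw [lt_div_iff₀ ha]; linarith
      have e3 : -1 ≤ r / a := (neg_one_le_cos θ).trans e2.le
      refine ⟨arccos (r / a), ⟨arccos_pos.2 e1, ?_⟩, ?_⟩
      · by_contra! hcon
        have := cos_le_cos_of_nonneg_of_le_pi h0.le (arccos_le_pi _) hcon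
        rw [cos_arccos e3 e1.le] at this
        linarith
      · simp only [cos_arccos e3 e1.le]
        field_simp
  rw [← himg, integral_image_eq_integral_abs_deriv_smul (f' := fun t => a * -sin t)
    measurableSet_Ioo (fun t _ => ((hasDerivAt_cos t).const_mul a).hasDerivWithinAt),
    ← integral_const_mul]
  · refine setIntegral_congr_fun measurableSet_Ioo fun t ht => ?_
    have hs : 0 < sin t := sin_pos_of_pos_of_lt_pi ht.1 (ht.2.trans_le h1)
    have e : sFun a (a * cos t) = sin t ^ (2 : ℝ) := by
      rw [rpow_two, sin_sq]; unfold sFun; field_simp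
    simp only [e, smul_eq_mul]
    rw [← rpow_mul hs.le, mul_neg, abs_neg, abs_of_pos (mul_pos ha hs)]
    obtain ⟨k, rfl⟩ := Nat.exists_eq_add_of_le hN
    have : (2 : ℝ) * (((2 + k : ℕ) : ℝ) / 2 - 1) = (k : ℕ) := by push_cast; ring
    rw [this, rpow_natCast, show 2 + k - 1 = k + 1 by omega]
    ring
  · intro x hx y hy hxy
    exact injOn_cos ⟨hx.1.le, hx.2.le.trans h1⟩ ⟨hy.1.le, hy.2.le.trans h1⟩
      (mul_left_cancel₀ ha.ne' hxy)

lemma wFun_integral (N : ℕ) (a c : ℝ) (hc : -a ≤ c) :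
    ∫ r in Set.Ioo c a, wFun N a r = (∫ r in Set.Ioo c a, sFun a r ^ ((N : ℝ) / 2 - 1)) /
      ∫ r in Set.Ioo (-a) a, sFun a r ^ ((N : ℝ) / 2 - 1) := by
  rw [← integral_div]
  refine setIntegral_congr_fun measurableSet_Ioo fun r hr => ?_
  have : |r| < a := abs_lt.2 ⟨by linarith [hr.1], hr.2⟩
  simp [wFun, this]

lemma lim_facts (α : ℝ) (hα : 0 < α) (a : ℕ → ℝ)
    (hlim : Tendsto (fun N : ℕ => a N / Real.sqrt ((N : ℝ) - 1)) atTop (nhds α)) :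
    Tendsto a atTop atTop ∧ Tendsto (fun N : ℕ => (N : ℝ) / a N ^ 2) atTop (nhds (1 / α ^ 2)) := by
  have hN1 : Tendsto (fun N : ℕ => (N : ℝ) - 1) atTop atTop :=
    tendsto_atTop_add_const_right _ (-1) tendsto_natCast_atTop_atTop
  have hA : Tendsto a atTop atTop := by
    refine (hlim.pos_mul_atTop hα (Real.tendsto_sqrt_atTop.comp hN1)).congr' ?_
    filter_upwards [eventually_ge_atTop 2] with N hN
    have : (0 : ℝ) < (N : ℝ) - 1 := by
      have : (2 : ℝ) ≤ N := by exact_mod_cast hN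
      linarith
    have := Real.sqrt_pos.2 this
    simp only [Function.comp]
    field_simp
  refine ⟨hA, ?_⟩
  have h2 : Tendsto (fun N => (a N ^ 2)⁻¹) atTop (nhds 0) :=
    tendsto_inv_atTop_zero.comp ((tendsto_pow_atTop two_ne_zero).comp hA)
  have h3 := ((hlim.pow 2).inv₀ (by positivity)).add h2
  rw [add_zero, ← one_div] at h3
  refine h3.congr' ?_
  filter_upwards [eventually_ge_atTop 2, hA.eventually_gt_atTop 0] with N hN hpos
  have : (0 : ℝ) ≤ (N : ℝ) - 1 := by
    have : (2 : ℝ) ≤ N := by exact_mod_cast hN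
    linarith
  rw [div_pow, Real.sq_sqrt this]
  field_simp
  ring

lemma ptwise (α : ℝ) (hα : 0 < α) (a : ℕ → ℝ) (hA : Tendsto a atTop atTop)
    (hr : Tendsto (fun N : ℕ => (N : ℝ) / a N ^ 2) atTop (nhds (1 / α ^ 2))) (r : ℝ) :
    Tendsto (fun N : ℕ => sFun (a N) r ^ ((N : ℝ) / 2 - 1)) atTop
      (nhds (Real.exp (-r ^ 2 / (2 * α ^ 2)))) := by
  have h2 : Tendsto (fun N => (a N ^ 2)⁻¹) atTop (nhds 0) :=
    tendsto_inv_atTop_zero.comp ((tendsto_pow_atTop two_ne_zero).comp hA)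
  have hs : Tendsto (fun N => sFun (a N) r) atTop (nhds 1) := by
    have := (h2.const_mul (r ^ 2)).const_sub 1
    simpa [sFun, div_eq_mul_inv] using this
  have hp : Tendsto (fun N : ℕ => (1 + -(r ^ 2 / a N ^ 2)) ^ N) atTop
      (nhds (Real.exp (-r ^ 2 / α ^ 2))) := by
    apply Real.tendsto_one_add_pow_exp_of_tendsto
    have := hr.const_mul (-r ^ 2)
    rw [mul_one_div] at this
    refine this.congr fun N => ?_
    ring
  have hq := (hp.rpow_const (p := (1 / 2 : ℝ)) (Or.inr (by norm_num))).div hs one_ne_zero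
  rw [← Real.exp_mul, div_one] at hq
  have e : -r ^ 2 / α ^ 2 * (1 / 2) = -r ^ 2 / (2 * α ^ 2) := by field_simp
  rw [e] at hq
  refine hq.congr' ?_
  filter_upwards [hs.eventually_const_lt one_pos] with N hN
  simp only [Pi.div_apply]
  rw [← sub_eq_add_neg]
  change (sFun (a N) r ^ N) ^ (1 / 2 : ℝ) / sFun (a N) r = _
  rw [← Real.rpow_natCast, ← Real.rpow_mul hN.le, Real.rpow_sub hN, Real.rpow_one, mul_one_div]

lemma domconv (α : ℝ) (hα : 0 < α) (a : ℕ → ℝ) (hA : Tendsto a atTop atTop)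
    (hr : Tendsto (fun N : ℕ => (N : ℝ) / a N ^ 2) atTop (nhds (1 / α ^ 2)))
    (S : ℕ → Set ℝ) (T : Set ℝ) (hS : ∀ N, MeasurableSet (S N)) (hT : MeasurableSet T)
    (hsub : ∀ N, 2 ≤ N → S N ⊆ Set.Ioo (-a N) (a N))
    (hconv : ∀ᵐ r : ℝ, (r ∈ T → ∀ᶠ N in atTop, r ∈ S N) ∧ (r ∉ T → ∀ᶠ N in atTop, r ∉ S N)) :
    Tendsto (fun N : ℕ => ∫ r in S N, sFun (a N) r ^ ((N : ℝ) / 2 - 1)) atTop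
      (nhds (∫ r in T, Real.exp (-r ^ 2 / (2 * α ^ 2)))) := by
  have h2 : Tendsto (fun N => (a N ^ 2)⁻¹) atTop (nhds 0) :=
    tendsto_inv_atTop_zero.comp ((tendsto_pow_atTop two_ne_zero).comp hA)
  have hpa : Tendsto (fun N : ℕ => ((N : ℝ) / 2 - 1) / a N ^ 2) atTop
      (nhds (1 / (2 * α ^ 2))) := by
    have := (hr.mul_const (1 / 2)).sub h2
    have e : 1 / α ^ 2 * (1 / 2) - 0 = 1 / (2 * α ^ 2) := by field_simp; ring
    rw [e] at this
    refine this.congr fun N => ?_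
    ring
  have hev := hpa.eventually_const_lt (show 1 / (4 * α ^ 2) < 1 / (2 * α ^ 2) by
    apply one_div_lt_one_div_of_lt <;> nlinarith [sq_pos_of_pos hα])
  have hb : 0 < 1 / (4 * α ^ 2) := by positivity
  simp_rw [← integral_indicator (hS _), ← integral_indicator hT]
  refine tendsto_integral_filter_of_dominated_convergence
    (fun r => Real.exp (-(1 / (4 * α ^ 2)) * r ^ 2)) ?_ ?_ (integrable_exp_neg_mul_sq hb) ?_
  · refine Eventually.of_forall fun N => ?_
    refine (Measurable.indicator ?_ (hS N)).aestronglyMeasurable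
    unfold sFun
    fun_prop
  · filter_upwards [hev, eventually_ge_atTop 2, hA.eventually_gt_atTop 0] with N h1 hN hpos
    refine Eventually.of_forall fun r => ?_
    by_cases hrS : r ∈ S N
    · rw [Set.indicator_of_mem hrS]
      have hab := abs_lt.2 (hsub N hN hrS)
      have hlt : r ^ 2 < a N ^ 2 := by
        rw [← sq_abs r]; exact pow_lt_pow_left₀ hab (abs_nonneg _) two_ne_zero
      have hs0 : 0 ≤ sFun (a N) r := by
        unfold sFun
        have := (div_lt_one (by positivity)).2 hlt
        linarith
      have hp0 : (0 : ℝ) ≤ (N : ℝ) / 2 - 1 := by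
        have : (2 : ℝ) ≤ N := by exact_mod_cast hN
        linarith
      rw [Real.norm_of_nonneg (Real.rpow_nonneg hs0 _)]
      have hse : sFun (a N) r ≤ Real.exp (-(r ^ 2 / a N ^ 2)) := by
        have := Real.add_one_le_exp (-(r ^ 2 / a N ^ 2))
        unfold sFun; linarith
      refine (Real.rpow_le_rpow hs0 hse hp0).trans ?_
      rw [← Real.exp_mul, Real.exp_le_exp]
      have := mul_le_mul_of_nonneg_right h1.le (sq_nonneg r)
      have e : -(r ^ 2 / a N ^ 2) * ((N : ℝ) / 2 - 1) = - (((N : ℝ) / 2 - 1) / a N ^ 2 * r ^ 2) := by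
        ring
      rw [e]; linarith
    · rw [Set.indicator_of_notMem hrS]; simp; positivity
  · filter_upwards [hconv] with r hrc
    by_cases h : r ∈ T
    · rw [Set.indicator_of_mem h]
      refine (ptwise α hα a hA hr r).congr' ?_
      filter_upwards [hrc.1 h] with N hN
      rw [Set.indicator_of_mem hN]
    · rw [Set.indicator_of_notMem h]
      refine tendsto_const_nhds.congr' ?_
      filter_upwards [hrc.2 h] with N hN
      rw [Set.indicator_of_notMem hN]

lemma gauss_total (α : ℝ) (hα : 0 < α) :
    Integrable (fun r : ℝ => Real.exp (-r ^ 2 / (2 * α ^ 2))) ∧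
    ∫ r : ℝ, Real.exp (-r ^ 2 / (2 * α ^ 2)) = Real.sqrt (2 * Real.pi) * α := by
  have e : (fun r : ℝ => Real.exp (-r ^ 2 / (2 * α ^ 2)))
      = fun r => Real.exp (-(1 / (2 * α ^ 2)) * r ^ 2) := by
    funext r; congr 1; ring
  rw [e]
  refine ⟨integrable_exp_neg_mul_sq (by positivity), ?_⟩
  rw [integral_gaussian]
  have : Real.pi / (1 / (2 * α ^ 2)) = (2 * Real.pi) * α ^ 2 := by field_simp
  rw [this, Real.sqrt_mul (by positivity), Real.sqrt_sq hα.le]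

/-- if `a_N/√(N−1) → α` and `a_N cos θ_N → αR`, the spherical-cap volume ratios
`∫_{a_N cos θ_N}^{a_N} w_{N,a_N}(r) dr = ∫_0^{θ_N} sin^{N−1}θ dθ / ∫_0^π sin^{N−1}θ dθ`
converge to `γ¹_α((αR,∞)) = ∫_{αR}^∞ w_∞(r) dr ∈ (0,1)`. -/
theorem cap_volume_ratio_tendsto_gaussian
    (α R : ℝ) (hα : 0 < α) (a θ : ℕ → ℝ)
    (ha : ∀ N, 2 ≤ N → 0 < a N) (hθ : ∀ N, 2 ≤ N → θ N ∈ Set.Ioo 0 Real.pi)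
    (hlim : Tendsto (fun N : ℕ => a N / Real.sqrt ((N : ℝ) - 1)) atTop (nhds α))
    (hcos : Tendsto (fun N : ℕ => a N * Real.cos (θ N)) atTop (nhds (α * R))) :
    (∀ N, 2 ≤ N →
      (∫ r in Set.Ioo (a N * Real.cos (θ N)) (a N), wFun N (a N) r)
        = (∫ t in Set.Ioo 0 (θ N), Real.sin t ^ (N - 1)) /
            ∫ t in Set.Ioo 0 Real.pi, Real.sin t ^ (N - 1)) ∧
    Tendsto (fun N : ℕ => ∫ r in Set.Ioo (a N * Real.cos (θ N)) (a N), wFun N (a N) r)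
      atTop (nhds (∫ r in Set.Ioi (α * R), wInf α r)) ∧
    (∫ r in Set.Ioi (α * R), wInf α r) ∈ Set.Ioo (0 : ℝ) 1 := by
  have part1 : ∀ N, 2 ≤ N →
      (∫ r in Set.Ioo (a N * Real.cos (θ N)) (a N), wFun N (a N) r)
        = (∫ t in Set.Ioo 0 (θ N), Real.sin t ^ (N - 1)) /
            ∫ t in Set.Ioo 0 Real.pi, Real.sin t ^ (N - 1) := by
    intro N hN
    have hpos := ha N hN
    have hc : -a N ≤ a N * Real.cos (θ N) := by nlinarith [Real.neg_one_le_cos (θ N)]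
    have hfull := cap_subst N hN (a N) Real.pi hpos Real.pi_pos le_rfl
    rw [Real.cos_pi, mul_neg_one] at hfull
    rw [wFun_integral N _ _ hc, hfull,
      cap_subst N hN (a N) (θ N) hpos (hθ N hN).1 (hθ N hN).2.le,
      mul_div_mul_left _ _ hpos.ne']
  obtain ⟨hA, hr⟩ := lim_facts α hα a hlim
  obtain ⟨hgi, htot⟩ := gauss_total α hα
  have hC : 0 < Real.sqrt (2 * Real.pi) * α := by positivity
  have hw : ∫ r in Set.Ioi (α * R), wInf α r
      = (∫ r in Set.Ioi (α * R), Real.exp (-r ^ 2 / (2 * α ^ 2))) /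
        (Real.sqrt (2 * Real.pi) * α) := by
    unfold wInf
    rw [integral_const_mul]; ring
  refine ⟨part1, ?_, ?_⟩
  · have hnum := domconv α hα a hA hr (fun N => Set.Ioo (a N * Real.cos (θ N)) (a N))
      (Set.Ioi (α * R)) (fun _ => measurableSet_Ioo) measurableSet_Ioi
      (fun N hN => Set.Ioo_subset_Ioo_left
        (by nlinarith [Real.neg_one_le_cos (θ N), ha N hN])) (by
        have : ∀ᵐ r : ℝ, r ≠ α * R := by simp [ae_iff]
        filter_upwards [this] with r hne
        constructor
        · intro h
          filter_upwards [hcos.eventually_lt_const h, hA.eventually_gt_atTop r] with N h1 h2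
          exact ⟨h1, h2⟩
        · intro h
          have h' : r < α * R := lt_of_le_of_ne (not_lt.1 h) hne
          filter_upwards [hcos.eventually_const_lt h'] with N h1 h2
          exact lt_asymm h1 h2.1)
    have hden := domconv α hα a hA hr (fun N => Set.Ioo (-a N) (a N))
      Set.univ (fun _ => measurableSet_Ioo) MeasurableSet.univ
      (fun N hN => subset_rfl) (Eventually.of_forall fun r => ⟨fun _ => by
          filter_upwards [hA.eventually_gt_atTop |r|] with N h
          exact abs_lt.1 h, fun h => absurd (Set.mem_univ r) h⟩)
    rw [Measure.restrict_univ, htot] at hden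
    rw [hw]
    refine (hnum.div hden hC.ne').congr' ?_
    filter_upwards [eventually_ge_atTop 2] with N hN
    have hc : -a N ≤ a N * Real.cos (θ N) := by
      nlinarith [Real.neg_one_le_cos (θ N), ha N hN]
    rw [wFun_integral N _ _ hc]
    rfl
  · have hposs : ∀ s : Set ℝ, volume s ≠ 0 →
        0 < ∫ r in s, Real.exp (-r ^ 2 / (2 * α ^ 2)) := by
      intro s hs
      rw [integral_pos_iff_support_of_nonneg (fun r => (Real.exp_pos _).le) hgi.integrableOn]
      have : Function.support (fun r : ℝ => Real.exp (-r ^ 2 / (2 * α ^ 2))) = Set.univ := by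
        ext r; simp [Real.exp_ne_zero]
      rw [this, Measure.restrict_apply_univ]
      exact pos_iff_ne_zero.2 hs
    have h1 := hposs (Set.Ioi (α * R)) (by simp)
    have h2 := hposs (Set.Iic (α * R)) (by simp)
    have h3 := intervalIntegral.integral_Iic_add_Ioi (b := α * R) hgi.integrableOn hgi.integrableOn
    rw [htot] at h3
    rw [hw]
    exact ⟨by positivity, (div_lt_one hC).2 (by linarith)⟩
end
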